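/- Let T be an n-tilting right R-module with heart H. Then H is closed under coproducts in D(R) if and only if the class T^{⊥₁} = {N : Ext¹_R(T, N) = 0} is closed under arbitrary direct sums in Mod-R. -/

import Mathlib

open CategoryTheory Limits DirectSum

universe u

noncomputable section

/-- `Ext^n_R(M, X) = 0`, via the `Ext` bifunctor on the abelian category of `R`-modules. -/
def ExtVanish (R : Type u) [Ring R] (n : ℕ) (M X : ModuleCat.{u} R) : Prop :=
  Subsingleton (((Ext ℤ (ModuleCat.{u} R) n).obj (Opposite.op M)).obj X)

/-- A module `M` is pure projective if it is a direct summand of a direct sum of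
finitely presented modules. -/
def IsPureProjective (R : Type u) [Ring R] (M : Type u) [AddCommGroup M] [Module R M] :
    Prop :=
  ∃ (ι : Type u) (F : ι → ModuleCat.{u} R),
    (∀ i, Module.FinitePresentation R (F i)) ∧
    ∃ (s : M →ₗ[R] (⨁ i, F i)) (r : (⨁ i, F i) →ₗ[R] M), r ∘ₗ s = LinearMap.id

/-- A submodule `Y ≤ X` is pure if every finitely presented module has the lifting
property with respect to the projection `X → X/Y` (equivalently, the inclusion stays
injective after tensoring by any module). -/
def IsPureSubmodule (R : Type u) [Ring R] (X : Type u) [AddCommGroup X] [Module R X]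
    (Y : Submodule R X) : Prop :=
  ∀ (F : Type u) [AddCommGroup F] [Module R F], Module.FinitePresentation R F →
    ∀ g : F →ₗ[R] (X ⧸ Y), ∃ h : F →ₗ[R] X, Y.mkQ ∘ₗ h = g

/-- The trace of `T` in `N`: the sum of the images of all homomorphisms `T → N`. -/
def traceSub (R : Type u) [Ring R] (T : Type u) [AddCommGroup T] [Module R T]
    (N : Type u) [AddCommGroup N] [Module R N] : Submodule R N :=
  ⨆ f : T →ₗ[R] N, LinearMap.range f

/-- `M` belongs to `Add T`: it is a direct summand of a direct sum of copies of `T`. -/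
def MemAddT (R : Type u) [Ring R] (T : Type u) [AddCommGroup T] [Module R T]
    (M : Type u) [AddCommGroup M] [Module R M] : Prop :=
  ∃ (κ : Type u) (s : M →ₗ[R] (κ →₀ T)) (p : (κ →₀ T) →ₗ[R] M), p ∘ₗ s = LinearMap.id

/-- `X` belongs to the class `T^⊥`, i.e. `Ext^i_R(T, X) = 0` for all `i ≥ 1`. -/
def InTPerp (R : Type u) [Ring R] (T : Type u) [AddCommGroup T] [Module R T]
    (X : ModuleCat.{u} R) : Prop :=
  ∀ i : ℕ, 1 ≤ i → ExtVanish R i (ModuleCat.of R T) X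

/-- A class of modules is closed under direct limits. -/
def ClosedUnderDirectLimits (R : Type u) [Ring R] (P : ModuleCat.{u} R → Prop) : Prop :=
  ∀ (ι : Type u) [Preorder ι] [IsDirected ι (· ≤ ·)] [Nonempty ι] [DecidableEq ι]
    (G : ι → ModuleCat.{u} R) (f : ∀ i j, i ≤ j → G i →ₗ[R] G j)
    [DirectedSystem (fun i => (G i : Type u)) (fun i j h => f i j h)],
    (∀ i, P (G i)) →
      P (ModuleCat.of R (Module.DirectLimit (fun i => (G i : Type u)) f))

/-- The trace functor of `T` commutes with direct limits: the trace of a direct limit is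
the supremum of the images of the traces of the components. -/
def TraceCommutesWithDirectLimits (R : Type u) [Ring R] (T : Type u) [AddCommGroup T]
    [Module R T] : Prop :=
  ∀ (ι : Type u) [Preorder ι] [IsDirected ι (· ≤ ·)] [Nonempty ι] [DecidableEq ι]
    (G : ι → ModuleCat.{u} R) (f : ∀ i j, i ≤ j → G i →ₗ[R] G j)
    [DirectedSystem (fun i => (G i : Type u)) (fun i j h => f i j h)],
    traceSub R T (Module.DirectLimit (fun i => (G i : Type u)) f) =
      ⨆ α, (traceSub R T (G α)).map (Module.DirectLimit.of R ι (fun i => (G i : Type u)) f α)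

/-- `T` is an `n`-tilting module: (T1) `pd T ≤ n` (expressed by the vanishing of
`Ext^i(T, -)` for `i > n`), (T2) `Ext^i(T, T^{(κ)}) = 0` for all `i ≥ 1` and all index
sets `κ`, (T3) `R` admits a finite exact coresolution by modules in `Add T`. -/
def IsNTilting (R : Type u) [Ring R] (n : ℕ) (T : Type u) [AddCommGroup T]
    [Module R T] : Prop :=
  (∀ (X : ModuleCat.{u} R) (i : ℕ), n < i → ExtVanish R i (ModuleCat.of R T) X) ∧
  (∀ (κ : Type u) (i : ℕ), 1 ≤ i →
    ExtVanish R i (ModuleCat.of R T) (ModuleCat.of R (κ →₀ T))) ∧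
  (∃ (U : ℕ → ModuleCat.{u} R) (ε : ModuleCat.of R R ⟶ U 0) (d : ∀ i, U i ⟶ U (i + 1)),
    (∀ i, MemAddT R T (U i)) ∧ Function.Injective ε ∧ Function.Exact ε (d 0) ∧
    (∀ i, Function.Exact (d i) (d (i + 1))) ∧ ∃ r, ∀ i, r < i → Subsingleton (U i))

universe w

open Pretriangulated

section Derived

variable (R : Type u) [Ring R] [HasDerivedCategory.{w} (ModuleCat.{u} R)]

/-- A module `T`, viewed as a stalk complex in degree `0` in the derived category of `R`. -/
def singleT (T : Type u) [AddCommGroup T] [Module R T] :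
    DerivedCategory (ModuleCat.{u} R) :=
  (DerivedCategory.singleFunctor (ModuleCat.{u} R) 0).obj (ModuleCat.of R T)

/-- The aisle `U = {X : Hom(T[i], X) = 0 for i < 0}` of the `t`-structure induced by `T`. -/
def aisleSet (T : Type u) [AddCommGroup T] [Module R T] :
    Set (DerivedCategory (ModuleCat.{u} R)) :=
  {X | ∀ i : ℤ, i < 0 → ∀ f : (singleT R T)⟦i⟧ ⟶ X, f = 0}

/-- The heart `H = {X : Hom(T[i], X) = 0 for i ≠ 0}` of the `t`-structure induced by `T`. -/
def heartSet (T : Type u) [AddCommGroup T] [Module R T] :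
    Set (DerivedCategory (ModuleCat.{u} R)) :=
  {X | ∀ i : ℤ, i ≠ 0 → ∀ f : (singleT R T)⟦i⟧ ⟶ X, f = 0}

end Derived

section ExtComparison

variable {R : Type u} [Ring R]

lemma extVanish_iff_subsingleton_ext (T N : ModuleCat.{u} R) [HasExt.{w} (ModuleCat.{u} R)]
    (k : ℕ) :
    ExtVanish R (k + 1) T N ↔ Subsingleton (Abelian.Ext.{w} T N (k + 1)) := by
  let P := projectiveResolution T
  rw [ExtVanish, (P.isoExt (R := ℤ) (k + 1) N).toLinearEquiv.toEquiv.subsingleton_congr,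
    ← ModuleCat.isZero_iff_subsingleton, ← HomologicalComplex.exactAt_iff_isZero_homology,
    HomologicalComplex.exactAt_iff' _ k (k + 1) (k + 2) (by simp) (by simp),
    ShortComplex.moduleCat_exact_iff]
  constructor
  · intro h
    refine subsingleton_of_forall_eq 0 fun α ↦ ?_
    obtain ⟨f, hf, rfl⟩ := P.extMk_surjective α (k + 2) rfl
    rw [P.extMk_eq_zero_iff f (k + 2) rfl hf k rfl]
    obtain ⟨g, hg⟩ := h f (by exact hf)
    exact ⟨g, by exact hg⟩
  · intro h f hf
    have := (P.extMk_eq_zero_iff (Y := N) f (k + 2) rfl (by exact hf) k rfl).1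
      (Subsingleton.elim _ _)
    obtain ⟨g, hg⟩ := this
    exact ⟨g, by exact hg⟩

end ExtComparison

section Vanishing

variable {C : Type*} [Category* C] [Preadditive C] [HasShift C ℤ]

/-- Every morphism `T ⟶ X⟦i⟧` is zero. -/
def HomVanish (T X : C) (i : ℤ) : Prop := ∀ f : T ⟶ X⟦i⟧, f = 0

/-- Every morphism `T ⟶ X⟦i⟧` with `i ≠ 0` is zero. -/
def InHeart (T X : C) : Prop := ∀ i : ℤ, i ≠ 0 → HomVanish T X i

end Vanishing

section HeartPredicate

variable {R : Type u} [Ring R] [HasDerivedCategory.{w} (ModuleCat.{u} R)]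

lemma extVanish_iff_homVanish (T N : ModuleCat.{u} R) (k : ℕ) (hk : 1 ≤ k) :
    ExtVanish R k T N ↔ HomVanish ((DerivedCategory.singleFunctor _ 0).obj T)
      ((DerivedCategory.singleFunctor _ 0).obj N) (k : ℤ) := by
  obtain ⟨k, rfl⟩ := Nat.exists_eq_add_of_le' hk
  have := hasExt_of_hasDerivedCategory.{w} (ModuleCat.{u} R)
  rw [extVanish_iff_subsingleton_ext.{u, w},
    (Abelian.Ext.homEquiv (C := ModuleCat.{u} R)).subsingleton_congr]
  exact ⟨fun h f ↦ Subsingleton.elim (α := ShiftedHom _ _ _) f 0,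
    fun h ↦ subsingleton_of_forall_eq 0 h⟩

lemma mem_heartSet_iff (T : Type u) [AddCommGroup T] [Module R T]
    (X : DerivedCategory (ModuleCat.{u} R)) :
    X ∈ heartSet R T ↔ InHeart (singleT R T) X := by
  have key (i : ℤ) : (∀ f : (singleT R T)⟦i⟧ ⟶ X, f = 0) ↔
      HomVanish (singleT R T) X (-i) := by
    have e := ((shiftEquiv (DerivedCategory (ModuleCat.{u} R)) i).toAdjunction.homEquiv
      (singleT R T) X).subsingleton_congr
    refine ⟨fun h f ↦ ?_, fun h f ↦ ?_⟩
    · have := e.1 (subsingleton_of_forall_eq 0 h)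
      exact this.elim f 0
    · have := e.2 (subsingleton_of_forall_eq 0 h)
      exact this.elim f 0
  refine ⟨fun h i hi ↦ ?_, fun h i hi ↦ ?_⟩
  · simpa using (key (-i)).1 (h (-i) (by lia))
  · exact (key i).2 (h (-i) (by lia))

end HeartPredicate

section QuasiIsoColimits

variable {J C : Type*} [Category* J] [Category* C] [Abelian C] [HasColimitsOfShape J C]
  [HasExactColimitsOfShape J C]

lemma quasiIso_colim_mapShortComplex_map {S₁ S₂ : ShortComplex (J ⥤ C)} (φ : S₁ ⟶ S₂)
    (h : ∀ j, ShortComplex.QuasiIso (((evaluation J C).obj j).mapShortComplex.map φ)) :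
    ShortComplex.QuasiIso ((colim (J := J) (C := C)).mapShortComplex.map φ) := by
  have hφ : ShortComplex.QuasiIso φ := by
    rw [ShortComplex.quasiIso_iff, NatTrans.isIso_iff_isIso_app]
    intro j
    have h₁ := (ShortComplex.quasiIso_iff _).1 (h j)
    have h₂ := ShortComplex.mapHomologyIso_hom_naturality φ ((evaluation J C).obj j)
    change IsIso (((evaluation J C).obj j).map (ShortComplex.homologyMap φ))
    rw [(Iso.eq_inv_comp _).2 h₂.symm]
    exact IsIso.comp_isIso' inferInstance (IsIso.comp_isIso' h₁ inferInstance)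
  exact ShortComplex.quasiIso_map_of_preservesLeftHomology colim φ

lemma quasiIso_of_isColimit {F G : J ⥤ ShortComplex C} (α : F ⟶ G)
    (hα : ∀ j, ShortComplex.QuasiIso (α.app j)) {cF : Cocone F} {cG : Cocone G}
    (hF : IsColimit cF) (hG : IsColimit cG) (φ : cF.pt ⟶ cG.pt)
    (hφ : ∀ j, cF.ι.app j ≫ φ = α.app j ≫ cG.ι.app j) : ShortComplex.QuasiIso φ := by
  let ψ : (ShortComplex.colimitCocone F).pt ⟶ (ShortComplex.colimitCocone G).pt :=
    (colim (J := J) (C := C)).mapShortComplex.map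
      ((ShortComplex.functorEquivalence J C).inverse.map α)
  have hψ : ShortComplex.QuasiIso ψ := quasiIso_colim_mapShortComplex_map _ hα
  let eF := (ShortComplex.isColimitColimitCocone F).coconePointUniqueUpToIso hF
  let eG := (ShortComplex.isColimitColimitCocone G).coconePointUniqueUpToIso hG
  have fac : ψ ≫ eG.hom = eF.hom ≫ φ := by
    refine (ShortComplex.isColimitColimitCocone F).hom_ext fun j ↦ ?_
    have h₁ : (ShortComplex.colimitCocone F).ι.app j ≫ ψ =
        α.app j ≫ (ShortComplex.colimitCocone G).ι.app j := by
      ext <;> exact colimit.ι_map _ _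
    simp only [eF, eG]
    rw [reassoc_of% h₁, IsColimit.comp_coconePointUniqueUpToIso_hom,
      IsColimit.comp_coconePointUniqueUpToIso_hom_assoc, hφ]
  have : ShortComplex.QuasiIso (eF.hom ≫ φ) := by rw [← fac]; infer_instance
  exact ShortComplex.quasiIso_of_comp_left eF.hom φ

lemma HomologicalComplex.quasiIso_of_isColimit {ι : Type*} {c : ComplexShape ι}
    {F G : J ⥤ HomologicalComplex C c} (α : F ⟶ G)
    (hα : ∀ j, QuasiIso (α.app j)) {cF : Cocone F} {cG : Cocone G}
    (hF : IsColimit cF) (hG : IsColimit cG) (φ : cF.pt ⟶ cG.pt)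
    (hφ : ∀ j, cF.ι.app j ≫ φ = α.app j ≫ cG.ι.app j) : QuasiIso φ := by
  rw [quasiIso_iff]
  intro n
  rw [quasiIsoAt_iff]
  let H := HomologicalComplex.shortComplexFunctor C c n
  have key {K : J ⥤ HomologicalComplex C c} {cK : Cocone K} (hK : IsColimit cK) :
      IsColimit (H.mapCocone cK) :=
    ShortComplex.isColimitOfIsColimitπ _
      (isColimitOfPreserves (HomologicalComplex.eval C c (c.prev n)) hK)
      (isColimitOfPreserves (HomologicalComplex.eval C c n) hK)
      (isColimitOfPreserves (HomologicalComplex.eval C c (c.next n)) hK)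
  refine _root_.quasiIso_of_isColimit (Functor.whiskerRight α H) (fun j ↦ ?_) (key hF) (key hG)
    (H.map φ) (fun j ↦ ?_)
  · have := (quasiIso_iff _).1 (hα j) n
    rwa [quasiIsoAt_iff] at this
  · simp [← Functor.map_comp, hφ]

end QuasiIsoColimits

section Coproducts

open DerivedCategory

variable {C : Type*} [Category* C] [Abelian C] {ι : Type*}

lemma CochainComplex.homotopy_of_isColimit_cofan [HasColimitsOfShape (Discrete ι) C]
    {K : ι → CochainComplex C ℤ} {c : Cofan K} (hc : IsColimit c)
    {L : CochainComplex C ℤ} {f g : c.pt ⟶ L}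
    (h : ∀ i, Homotopy (c.inj i ≫ f) (c.inj i ≫ g)) : Nonempty (Homotopy f g) := by
  have hn (n : ℤ) : IsColimit (Cofan.mk (c.pt.X n) (fun i ↦ (c.inj i).f n) :
      Cofan fun i ↦ (K i).X n) :=
    (Cofan.isColimitMapCoconeEquiv (HomologicalComplex.eval C _ n) _ _)
      (isColimitOfPreserves (HomologicalComplex.eval C _ n) hc)
  refine ⟨⟨fun p q ↦ Cofan.IsColimit.desc (hn p) fun i ↦ (h i).hom p q, ?_, ?_⟩⟩
  · intro p q hpq
    refine Cofan.IsColimit.hom_ext (hn p) _ _ fun i ↦ ?_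
    rw [Cofan.IsColimit.fac]
    simp [(h i).zero p q hpq]
  · intro n
    refine Cofan.IsColimit.hom_ext (hn n) _ _ fun i ↦ ?_
    have e (p q : ℤ) : (c.inj i).f p ≫ (Cofan.IsColimit.desc (hn p) fun i ↦ (h i).hom p q) =
      (h i).hom p q := Cofan.IsColimit.fac (hn p) (fun i ↦ (h i).hom p q) i
    have := (h i).comm n
    simp only [dNext, prevD, AddMonoidHom.mk'_apply, HomologicalComplex.comp_f] at this
    simp only [cofan_mk_inj, dNext, prevD, AddMonoidHom.mk'_apply, Preadditive.comp_add,
      HomologicalComplex.Hom.comm_assoc, reassoc_of% e, e, this]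

lemma CochainComplex.quasiIso_cofan_desc [HasColimitsOfShape (Discrete ι) C]
    [HasExactColimitsOfShape (Discrete ι) C] {K L : ι → CochainComplex C ℤ}
    {c : Cofan K} {d : Cofan L} (hc : IsColimit c) (hd : IsColimit d)
    (φ : ∀ i, K i ⟶ L i) (h : ∀ i, QuasiIso (φ i)) :
    QuasiIso (Cofan.IsColimit.desc hc fun i ↦ φ i ≫ d.inj i) :=
  HomologicalComplex.quasiIso_of_isColimit
    (Discrete.natTrans (F := Discrete.functor K) (G := Discrete.functor L) fun i ↦ φ i.as)
    (fun j ↦ h j.as)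
    hc hd _ (fun j ↦ Cofan.IsColimit.fac hc _ j.as)

variable [HasDerivedCategory.{w} C]

lemma DerivedCategory.exists_quasiIso_homotopy_zero {K L : CochainComplex C ℤ} (b : K ⟶ L)
    (hb : Q.map b = 0) : ∃ (M : CochainComplex C ℤ) (t : M ⟶ K), QuasiIso t ∧
      Nonempty (Homotopy (t ≫ b) 0) := by
  have h : Qh.map ((HomotopyCategory.quotient C _).map b) = Qh.map 0 := by
    rw [Functor.map_zero]
    exact hb
  rw [MorphismProperty.map_eq_iff_precomp Qh (HomotopyCategory.quasiIso C (ComplexShape.up ℤ))] at h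
  obtain ⟨M, s, hs, fac⟩ := h
  obtain ⟨M, rfl⟩ := HomotopyCategory.quotient_obj_surjective M
  obtain ⟨t, rfl⟩ := (HomotopyCategory.quotient _ _).map_surjective s
  refine ⟨M, t, ?_, ⟨HomotopyCategory.homotopyOfEq _ _ ?_⟩⟩
  · rwa [HomotopyCategory.quotient_map_mem_quasiIso_iff] at hs
  · simpa using fac

variable [HasColimitsOfShape (Discrete ι) C] [HasExactColimitsOfShape (Discrete ι) C]

lemma DerivedCategory.nonempty_isColimit_Q {K : ι → CochainComplex C ℤ} {c : Cofan K}
    (hc : IsColimit c) :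
    Nonempty (IsColimit (Cofan.mk (Q.obj c.pt) (fun i ↦ Q.map (c.inj i)))) := by
  have ex (Z : DerivedCategory C) (f : ∀ i, Q.obj (K i) ⟶ Z) :
      ∃ F : Q.obj c.pt ⟶ Z, ∀ i, Q.map (c.inj i) ≫ F = f i := by
    obtain ⟨L, ⟨e⟩⟩ : ∃ L, Nonempty (Q.obj L ≅ Z) := ⟨_, ⟨Q.objObjPreimageIso Z⟩⟩
    choose M s hs g hg using fun i ↦ right_fac (f i ≫ e.inv)
    have hs' (i) : QuasiIso (s i) := by rw [← isIso_Q_map_iff_quasiIso]; exact hs i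
    let d := colimit.cocone (Discrete.functor M)
    have hd : IsColimit d := colimit.isColimit _
    let σ := Cofan.IsColimit.desc hd fun i ↦ s i ≫ c.inj i
    have hσ : IsIso (Q.map σ) := by
      rw [isIso_Q_map_iff_quasiIso]
      exact CochainComplex.quasiIso_cofan_desc hd hc s hs'
    refine ⟨inv (Q.map σ) ≫ Q.map (Cofan.IsColimit.desc hd g) ≫ e.hom, fun i ↦ ?_⟩
    have h₁ : Q.map (s i) ≫ Q.map (c.inj i) = Q.map (Cofan.inj d i) ≫ Q.map σ := by
      rw [← Q.map_comp, ← Q.map_comp, Cofan.IsColimit.fac]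
    have h₂ : Q.map (Cofan.inj d i) ≫ Q.map (Cofan.IsColimit.desc hd g) =
        Q.map (s i) ≫ f i ≫ e.inv := by
      rw [← Q.map_comp, Cofan.IsColimit.fac, hg i, IsIso.hom_inv_id_assoc]
    rw [← cancel_epi (Q.map (s i)), reassoc_of% h₁, IsIso.hom_inv_id_assoc, reassoc_of% h₂,
      e.inv_hom_id, Category.comp_id]
  have uniq (Z : DerivedCategory C) (F : Q.obj c.pt ⟶ Z) (hF : ∀ i, Q.map (c.inj i) ≫ F = 0) :
      F = 0 := by
    obtain ⟨L, ⟨e⟩⟩ : ∃ L, Nonempty (Q.obj L ≅ Z) := ⟨_, ⟨Q.objObjPreimageIso Z⟩⟩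
    obtain ⟨L', a, s, hs, hF'⟩ := left_fac (F ≫ e.inv)
    have ha (i) : Q.map (c.inj i ≫ a) = 0 := by
      have h₁ : Q.map a = F ≫ e.inv ≫ Q.map s := by
        rw [← Category.assoc, hF', Category.assoc, IsIso.inv_hom_id, Category.comp_id]
      rw [Q.map_comp, h₁, reassoc_of% (hF i), zero_comp]
    choose M t ht H using fun i ↦ exists_quasiIso_homotopy_zero _ (ha i)
    let d := colimit.cocone (Discrete.functor M)
    have hd : IsColimit d := colimit.isColimit _
    let σ := Cofan.IsColimit.desc hd fun i ↦ t i ≫ c.inj i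
    have hσ : IsIso (Q.map σ) := by
      rw [isIso_Q_map_iff_quasiIso]
      exact CochainComplex.quasiIso_cofan_desc hd hc t ht
    have e₁ (i) : Cofan.inj d i ≫ σ = t i ≫ c.inj i := Cofan.IsColimit.fac hd _ i
    obtain ⟨h⟩ := CochainComplex.homotopy_of_isColimit_cofan hd (f := σ ≫ a) (g := 0) fun i ↦
      (Homotopy.ofEq (by rw [← Category.assoc, e₁, Category.assoc])).trans
        ((H i).some.trans (Homotopy.ofEq comp_zero.symm))
    have h₀ : Q.map σ ≫ Q.map a = 0 := by
      rw [← Q.map_comp, Q_map_eq_of_homotopy _ h, Q.map_zero]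
    have h₁ : Q.map a = 0 := by rwa [← cancel_epi (Q.map σ), comp_zero]
    rw [← cancel_mono e.inv, hF', h₁, zero_comp, zero_comp]
  choose F hF using ex
  refine ⟨Cofan.IsColimit.mk _ (fun s ↦ F s.pt s.inj) (fun s j ↦ hF _ _ j) fun s m hm ↦ ?_⟩
  rw [← sub_eq_zero]
  refine uniq _ _ fun i ↦ ?_
  rw [Preadditive.comp_sub, hF, sub_eq_zero]
  exact hm i

end Coproducts

section Coproducts

open DerivedCategory

variable {C : Type*} [Category* C] [Abelian C] {ι : Type*} [HasDerivedCategory.{w} C]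
  [HasColimitsOfShape (Discrete ι) C] [HasExactColimitsOfShape (Discrete ι) C]

lemma DerivedCategory.preservesColimitsOfShape_Q :
    PreservesColimitsOfShape (Discrete ι) (Q (C := C)) where
  preservesColimit {F} :=
    have : PreservesColimit (Discrete.functor (F.obj ∘ Discrete.mk)) (Q (C := C)) :=
      ⟨fun {c} hc ↦ ⟨(Cofan.isColimitMapCoconeEquiv Q _ c).symm (nonempty_isColimit_Q hc).some⟩⟩
    preservesColimit_of_iso_diagram _ Discrete.natIsoFunctor.symm

lemma DerivedCategory.preservesColimitsOfShape_singleFunctor (n : ℤ) :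
    PreservesColimitsOfShape (Discrete ι) (singleFunctor C n) :=
  have := preservesColimitsOfShape_Q (C := C) (ι := ι)
  have : PreservesColimitsOfShape (Discrete ι) (CochainComplex.singleFunctor C n) :=
    inferInstanceAs (PreservesColimitsOfShape _ (HomologicalComplex.single C _ n))
  have := Limits.comp_preservesColimitsOfShape (J := Discrete ι)
    (CochainComplex.singleFunctor C n) (Q (C := C))
  preservesColimitsOfShape_of_natIso (singleFunctorIsoCompQ C n).symm

lemma DerivedCategory.hasColimitsOfShape_discrete :
    HasColimitsOfShape (Discrete ι) (DerivedCategory C) := by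
  have := preservesColimitsOfShape_Q (C := C) (ι := ι)
  refine ⟨fun F ↦ ?_⟩
  let K (i : ι) := Q.objPreimage (F.obj ⟨i⟩)
  have h : HasColimit (Discrete.functor K ⋙ Q) := inferInstance
  exact hasColimit_of_iso (F := Discrete.functor K ⋙ Q)
    (Discrete.natIso fun i ↦ (Q.objObjPreimageIso (F.obj i)).symm)

lemma DerivedCategory.isLE_coproduct {X : ι → DerivedCategory C} (n : ℤ)
    (hX : ∀ i, (X i).IsLE n) {c : Cofan X} (hc : IsColimit c) : c.pt.IsLE n := by
  choose K hK e using fun i ↦ exists_iso_Q_obj_of_isLE (X i) n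
  let d := colimit.cocone (Discrete.functor K)
  have hd : IsColimit d := colimit.isColimit _
  obtain ⟨h⟩ := nonempty_isColimit_Q hd
  have : CochainComplex.IsStrictlyLE d.pt n := by
    rw [CochainComplex.isStrictlyLE_iff]
    intro i hi
    rw [IsZero.iff_id_eq_zero]
    refine (isColimitOfPreserves (HomologicalComplex.eval C _ i) hd).hom_ext fun j ↦ ?_
    exact (CochainComplex.isZero_of_isStrictlyLE (K j.as) n i hi).eq_of_src _ _
  let E : Q.obj d.pt ≅ c.pt :=
    h.coconePointsIsoOfNatIso hc (Discrete.natIso fun i ↦ (e i.as).some.symm)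
  exact TStructure.t.isLE_of_iso E n

end Coproducts

section Triangulated

variable {C : Type*} [Category* C] [Preadditive C]

lemma eq_zero_of_fac_left {X Y Z : C} {f : X ⟶ Z} {g : X ⟶ Y} {m : Y ⟶ Z} (h : f = g ≫ m)
    (hg : g = 0) : f = 0 := by
  rw [h, hg, zero_comp]

lemma eq_zero_of_fac_right {X Y Z : C} {f : X ⟶ Z} {g : Y ⟶ Z} {m : X ⟶ Y} (h : f = m ≫ g)
    (hg : g = 0) : f = 0 := by
  rw [h, hg, comp_zero]

variable [HasShift C ℤ]

lemma HomVanish.of_iso {T T' X X' : C} {i : ℤ} (h : HomVanish T X i) (e : T' ≅ T)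
    (e' : X ≅ X') : HomVanish T' X' i := by
  intro f
  have := h (e.inv ≫ f ≫ ((shiftFunctor C i).mapIso e').inv)
  rwa [Preadditive.IsIso.comp_left_eq_zero, Preadditive.IsIso.comp_right_eq_zero] at this

lemma InHeart.of_iso {T X X' : C} (h : InHeart T X) (e : X ≅ X') : InHeart T X' :=
  fun i hi ↦ (h i hi).of_iso (Iso.refl _) e

lemma homVanish_shift_iff {T X : C} {a b c : ℤ} (h : a + b = c) :
    HomVanish T (X⟦a⟧) b ↔ HomVanish T X c := by
  let e := (shiftFunctorAdd' C a b c h).app X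
  refine ⟨fun H f ↦ ?_, fun H f ↦ ?_⟩
  · have := H (f ≫ e.hom)
    rwa [Preadditive.IsIso.comp_right_eq_zero] at this
  · have := H (f ≫ e.inv)
    rwa [Preadditive.IsIso.comp_right_eq_zero] at this

variable [∀ n : ℤ, (shiftFunctor C n).Additive]

lemma homVanish_shift_shift_iff {T X : C} {i : ℤ} :
    HomVanish (T⟦(1 : ℤ)⟧) (X⟦(1 : ℤ)⟧) i ↔ HomVanish T X i := by
  have h := homVanish_shift_iff (T := T⟦(1 : ℤ)⟧) (X := X) (add_comm (1 : ℤ) i)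
  have h' : HomVanish (T⟦(1 : ℤ)⟧) X (i + 1) ↔ HomVanish T X i := by
    let e := (shiftFunctorAdd' C i 1 _ rfl).app X
    refine ⟨fun H f ↦ ?_, fun H f ↦ ?_⟩
    · have := H (f⟦(1 : ℤ)⟧' ≫ e.inv)
      rw [Preadditive.IsIso.comp_right_eq_zero] at this
      exact (shiftFunctor C (1 : ℤ)).map_injective (by simpa using this)
    · obtain ⟨g, hg⟩ := (shiftFunctor C (1 : ℤ)).map_surjective (f ≫ e.hom)
      rw [← Preadditive.IsIso.comp_right_eq_zero f e.hom, ← hg, H g, Functor.map_zero]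
  exact h.trans h'

variable [HasZeroObject C] [Pretriangulated C] {Tr : Triangle C} {T : C}

lemma HomVanish.obj₃ (hTr : Tr ∈ distTriang C) {i : ℤ}
    (h₂ : HomVanish T Tr.obj₂ i) (h₁ : HomVanish T Tr.obj₁ (i + 1)) :
    HomVanish T Tr.obj₃ i := by
  intro f
  obtain ⟨g, hg⟩ := Triangle.coyoneda_exact₃ _ (Triangle.shift_distinguished _ hTr i) f
    ((homVanish_shift_iff rfl).2 h₁ _)
  exact eq_zero_of_fac_left hg (h₂ g)

lemma HomVanish.obj₁ (hTr : Tr ∈ distTriang C) {i : ℤ}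
    (h₃ : HomVanish T Tr.obj₃ i) (h₂ : HomVanish T Tr.obj₂ (i + 1)) :
    HomVanish T Tr.obj₁ (i + 1) := by
  rw [← homVanish_shift_iff (a := i) (b := 1) rfl]
  intro f
  obtain ⟨g, hg⟩ := Triangle.coyoneda_exact₁ _ (Triangle.shift_distinguished _ hTr i) f
    ((homVanish_shift_iff rfl).2 h₂ _)
  exact eq_zero_of_fac_left hg (h₃ g)

lemma HomVanish.left_obj₁ (hTr : Tr ∈ distTriang C) {Z : C} {i : ℤ} (h₂ : HomVanish Tr.obj₂ Z i)
    (h₃ : HomVanish Tr.obj₃ Z (i + 1)) : HomVanish Tr.obj₁ Z i := by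
  rw [← homVanish_shift_shift_iff]
  intro f
  obtain ⟨g, hg⟩ := Triangle.yoneda_exact₃ _ (rot_of_distTriang _ hTr) f
    ((homVanish_shift_iff (add_comm _ _)).2 h₃ _)
  exact eq_zero_of_fac_right hg (homVanish_shift_shift_iff.2 h₂ g)

lemma HomVanish.left_obj₃ (hTr : Tr ∈ distTriang C) {Z : C}
    {i : ℤ} (h₂ : HomVanish Tr.obj₂ Z (i + 1))
    (h₁ : HomVanish Tr.obj₁ Z i) : HomVanish Tr.obj₃ Z (i + 1) := by
  rw [← homVanish_shift_iff (add_comm 1 i)]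
  intro f
  obtain ⟨g, hg⟩ := Triangle.yoneda_exact₃ _ hTr f
    ((homVanish_shift_iff (add_comm _ _)).2 h₂ _)
  exact eq_zero_of_fac_right hg (homVanish_shift_shift_iff.2 h₁ g)

lemma comp_mor₁_eq_zero_imp (hTr : Tr ∈ distTriang C)
    (h₃ : HomVanish T Tr.obj₃ (-1)) (f : T ⟶ Tr.obj₁)
    (hf : f ≫ Tr.mor₁ = 0) : f = 0 := by
  obtain ⟨g, hg⟩ := Triangle.coyoneda_exact₂ _ (inv_rot_of_distTriang _ hTr) f hf
  exact eq_zero_of_fac_left hg (h₃ g)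

lemma HomVanish.obj₃_neg_one (hTr : Tr ∈ distTriang C) (h₂ : HomVanish T Tr.obj₂ (-1))
    (h : ∀ f : T ⟶ Tr.obj₁, f ≫ Tr.mor₁ = 0 → f = 0) : HomVanish T Tr.obj₃ (-1) := by
  intro f
  have hd := inv_rot_of_distTriang _ hTr
  obtain ⟨g, hg⟩ := Triangle.coyoneda_exact₂ _ (inv_rot_of_distTriang _ hd) f
    (h _ ((Category.assoc _ _ _).trans
      (eq_zero_of_fac_right rfl (comp_distTriang_mor_zero₁₂ _ hd))))
  exact eq_zero_of_fac_left hg (h₂ g)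

lemma InHeart.obj₃ (hTr : Tr ∈ distTriang C) (h₁ : InHeart T Tr.obj₁) (h₂ : InHeart T Tr.obj₂)
    (h : ∀ f : T ⟶ Tr.obj₁, f ≫ Tr.mor₁ = 0 → f = 0) : InHeart T Tr.obj₃ := by
  intro i hi
  by_cases hi' : i = -1
  · subst hi'
    exact HomVanish.obj₃_neg_one hTr (h₂ (-1) hi) h
  · exact HomVanish.obj₃ hTr (h₂ i hi) (h₁ _ (by lia))

end Triangulated

section Sigma

variable {C : Type*} [Category* C] [Preadditive C] [HasShift C ℤ] [HasZeroObject C]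
  [∀ n : ℤ, (shiftFunctor C n).Additive] [Pretriangulated C] {ι : Type*}
  [HasColimitsOfShape (Discrete ι) C]

lemma exists_sigma_distinguished {X₁ X₂ X₃ : ι → C} (u : ∀ j, X₁ j ⟶ X₂ j) (v : ∀ j, X₂ j ⟶ X₃ j)
    (w : ∀ j, X₃ j ⟶ (X₁ j)⟦(1 : ℤ)⟧) (hT : ∀ j, Triangle.mk (u j) (v j) (w j) ∈ distTriang C) :
    ∃ h : (∐ X₃) ⟶ (∐ X₁)⟦(1 : ℤ)⟧,
      Triangle.mk (Limits.Sigma.map u) (Limits.Sigma.map v) h ∈ distTriang C := by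
  obtain ⟨Z, f₂, f₃, hT'⟩ := distinguished_cocone_triangle (Limits.Sigma.map u)
  have hs (Y : ι → C) : IsColimit (Cofan.mk ((∐ Y)⟦(1 : ℤ)⟧) fun j ↦ (Sigma.ι Y j)⟦(1 : ℤ)⟧') :=
    Cofan.isColimitMapCoconeEquiv (shiftFunctor C (1 : ℤ)) _ _
      (isColimitOfPreserves (shiftFunctor C (1 : ℤ)) (coproductIsCoproduct Y))
  have hφ (j) : ∃ φ : X₃ j ⟶ Z, v j ≫ φ = Sigma.ι X₂ j ≫ f₂ ∧
      w j ≫ (Sigma.ι X₁ j)⟦(1 : ℤ)⟧' = φ ≫ f₃ :=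
    complete_distinguished_triangle_morphism _ _ (hT j) hT' (Sigma.ι X₁ j) (Sigma.ι X₂ j)
      (Limits.Sigma.ι_map u j).symm
  choose φ hφ₂ hφ₃ using hφ
  let c : (∐ X₃) ⟶ Z := Limits.Sigma.desc φ
  have hcφ (j) : Sigma.ι X₃ j ≫ c = φ j := by simp [c]
  have hc₂ : Limits.Sigma.map v ≫ c = f₂ := by
    ext j
    simp [c, hφ₂]
  have hc₃ (j) : Sigma.ι X₃ j ≫ c ≫ f₃ = w j ≫ (Sigma.ι X₁ j)⟦(1 : ℤ)⟧' := by
    rw [hφ₃, ← hcφ, Category.assoc]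
  have zero₃₁ : f₃ ≫ (Limits.Sigma.map u)⟦(1 : ℤ)⟧' = 0 := comp_distTriang_mor_zero₃₁ _ hT'
  have huv (j) : u j ≫ v j = 0 := comp_distTriang_mor_zero₁₂ _ (hT j)
  have hc : IsIso c := by
    refine isIso_of_coyoneda_map_bijective _ fun A ↦ ⟨?_, fun a ↦ ?_⟩
    · suffices ∀ f : Z ⟶ A, c ≫ f = 0 → f = 0 by
        intro a b hab
        rw [← sub_eq_zero]
        refine this _ ?_
        rw [Preadditive.comp_sub, sub_eq_zero]
        exact hab
      intro f hf
      obtain ⟨g, hg⟩ : ∃ g : (∐ X₁)⟦(1 : ℤ)⟧ ⟶ A, f = f₃ ≫ g :=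
        Triangle.yoneda_exact₃ _ hT' f (by
          change f₂ ≫ f = 0
          rw [← hc₂, Category.assoc, hf, comp_zero])
      have hg' (j) : ∃ a : (X₂ j)⟦(1 : ℤ)⟧ ⟶ A,
          (Sigma.ι X₁ j)⟦(1 : ℤ)⟧' ≫ g = (u j)⟦(1 : ℤ)⟧' ≫ a := by
        have h0 : w j ≫ (Sigma.ι X₁ j)⟦(1 : ℤ)⟧' ≫ g = 0 := by
          rw [reassoc_of% (hφ₃ j), ← hg, ← hcφ, Category.assoc, hf, comp_zero]
        obtain ⟨a, ha⟩ : ∃ a : (X₂ j)⟦(1 : ℤ)⟧ ⟶ A,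
            (Sigma.ι X₁ j)⟦(1 : ℤ)⟧' ≫ g = (-(u j)⟦(1 : ℤ)⟧') ≫ a :=
          Triangle.yoneda_exact₃ _ (rot_of_distTriang _ (hT j)) _ h0
        exact ⟨-a, by rw [ha]; simp⟩
      choose a ha using hg'
      have : g = (Limits.Sigma.map u)⟦(1 : ℤ)⟧' ≫ Cofan.IsColimit.desc (hs X₂) a := by
        refine Cofan.IsColimit.hom_ext (hs X₁) _ _ fun j ↦ ?_
        have e := Cofan.IsColimit.fac (hs X₂) a j
        simp only [cofan_mk_inj] at e ⊢
        rw [ha, ← Functor.map_comp_assoc, Limits.Sigma.ι_map, Functor.map_comp_assoc, e]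
      rw [hg, this, reassoc_of% zero₃₁, zero_comp]
    · have h0 : Limits.Sigma.map u ≫ Limits.Sigma.map v ≫ a = 0 := by
        ext j
        simp [reassoc_of% huv j]
      obtain ⟨a₁, ha₁⟩ : ∃ a₁ : Z ⟶ A, Limits.Sigma.map v ≫ a = f₂ ≫ a₁ :=
        Triangle.yoneda_exact₂ _ hT' _ h0
      have hb (j) : ∃ b : (X₁ j)⟦(1 : ℤ)⟧ ⟶ A, Sigma.ι X₃ j ≫ (a - c ≫ a₁) = w j ≫ b :=
        Triangle.yoneda_exact₃ _ (hT j) _ (show v j ≫ Sigma.ι X₃ j ≫ (a - c ≫ a₁) = 0 by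
          rw [← Limits.Sigma.ι_map_assoc, Preadditive.comp_sub, ha₁, reassoc_of% hc₂, sub_self,
            comp_zero])
      choose b hb using hb
      have e := Cofan.IsColimit.fac (hs X₁) b
      simp only [cofan_mk_inj] at e
      refine ⟨a₁ + f₃ ≫ Cofan.IsColimit.desc (hs _) b, ?_⟩
      change c ≫ (_ + _) = a
      rw [Preadditive.comp_add, ← eq_sub_iff_add_eq']
      ext j
      rw [hb, ← e, reassoc_of% (hφ₃ j), ← hcφ]
      simp only [Category.assoc]
  refine ⟨c ≫ f₃, isomorphic_distinguished _ hT' _ ?_⟩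
  let e : (∐ X₃) ≅ Z := asIso c
  refine Triangle.isoMk _ _ (Iso.refl (∐ X₁)) (Iso.refl (∐ X₂)) e ?_ ?_ ?_
  · exact (Category.comp_id _).trans (Category.id_comp _).symm
  · exact hc₂.trans (Category.id_comp _).symm
  · change (c ≫ f₃) ≫ (𝟙 (∐ X₁))⟦(1 : ℤ)⟧' = c ≫ f₃
    simp

end Sigma

section Abelian

open DerivedCategory

variable {C : Type*} [Category* C] [Abelian C] [HasDerivedCategory C]

lemma DerivedCategory.exists_Q_map_eq {K L : CochainComplex C ℤ} [K.IsKProjective]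
    (f : Q.obj K ⟶ Q.obj L) : ∃ g : K ⟶ L, Q.map g = f := by
  obtain ⟨g, hg⟩ := (CochainComplex.IsKProjective.Qh_map_bijective K _).surjective
    ((quotientCompQhIso C).hom.app K ≫ f ≫ (quotientCompQhIso C).inv.app L)
  obtain ⟨g, rfl⟩ := (HomotopyCategory.quotient C (.up ℤ)).map_surjective g
  refine ⟨g, ?_⟩
  have := (quotientCompQhIso C).hom.naturality g
  rw [← cancel_epi ((quotientCompQhIso C).hom.app K), ← this]
  simp [hg]

lemma homVanish_single_of_projective (P : C) [Projective P] (Z : DerivedCategory C) [Z.IsLE 0]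
    (i : ℤ) (hi : 0 < i) : HomVanish ((singleFunctor C 0).obj P) Z i := by
  intro f
  have : (Z⟦i⟧).IsLE (-i) := TStructure.t.isLE_shift Z 0 i (-i)
  obtain ⟨K, hK, ⟨e⟩⟩ := exists_iso_Q_obj_of_isLE (Z⟦i⟧) (-i)
  let L := (CochainComplex.singleFunctor C 0).obj P
  have : ∀ n, Projective (L.X n) := by
    intro n
    by_cases hn : n = 0
    · subst hn
      exact Projective.of_iso (HomologicalComplex.singleObjXSelf (.up ℤ) 0 P).symm inferInstance
    · have := (HomologicalComplex.isZero_single_obj_X (.up ℤ) 0 P n hn)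
      exact Projective.of_iso (this.isoZero).symm inferInstance
  have : L.IsKProjective := CochainComplex.isKProjective_of_projective L 0
  let e' : (singleFunctor C 0).obj P ≅ Q.obj L := (singleFunctorIsoCompQ C 0).app P
  obtain ⟨g, hg⟩ := exists_Q_map_eq (e'.inv ≫ f ≫ e.hom)
  have hg' : g = 0 := by
    ext n
    by_cases hn : n = 0
    · exact (K.isZero_of_isStrictlyLE (-i) n (by lia)).eq_of_tgt _ _
    · exact (HomologicalComplex.isZero_single_obj_X (.up ℤ) 0 P n hn).eq_of_src _ _
  rw [hg', Functor.map_zero] at hg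
  rw [← cancel_epi e'.inv, ← cancel_mono e.hom, Category.assoc, ← hg]
  simp

lemma homVanish_single_of_neg (M N : C) (i : ℤ) (hi : i < 0) :
    HomVanish ((singleFunctor C 0).obj M) ((singleFunctor C 0).obj N) i := fun f ↦ by
  have : (((singleFunctor C 0).obj N)⟦i⟧).IsGE (-i) := TStructure.t.isGE_shift _ 0 i (-i)
  exact TStructure.t.zero f 0 (-i) (by lia)

/-- An object of projective dimension at most `n` has no morphisms to objects concentrated in
degrees less than `-n`. -/
lemma homVanish_single_of_isLE [EnoughProjectives C] (n : ℕ) (M : C)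
    (hM : ∀ (X : C) (i : ℤ), n < i →
      HomVanish ((singleFunctor C 0).obj M) ((singleFunctor C 0).obj X) i)
    (Z : DerivedCategory C) [Z.IsLE 0] (i : ℤ) (hi : n < i) :
    HomVanish ((singleFunctor C 0).obj M) Z i := by
  induction n generalizing M i with
  | zero =>
    let S := ShortComplex.mk (kernel.ι (Projective.π M)) (Projective.π M) (by simp)
    have hS : S.ShortExact :=
      { exact := ShortComplex.exact_kernel _
        mono_f := by dsimp [S]; infer_instance
        epi_g := by dsimp [S]; infer_instance }
    obtain ⟨s, hs⟩ : ∃ s : (singleFunctor C 0).obj M ⟶ (singleFunctor C 0).obj S.X₂,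
        𝟙 _ = s ≫ (singleFunctor C 0).map S.g :=
      Triangle.coyoneda_exact₃ _ hS.singleTriangle_distinguished (𝟙 _)
        (hM _ 1 (by simp) _)
    intro f
    rw [← Category.id_comp f, hs, Category.assoc]
    exact eq_zero_of_fac_right rfl (homVanish_single_of_projective _ Z i (by simpa using hi) _)
  | succ n ih =>
    let S := ShortComplex.mk (kernel.ι (Projective.π M)) (Projective.π M) (by simp)
    have hS : S.ShortExact :=
      { exact := ShortComplex.exact_kernel _
        mono_f := by dsimp [S]; infer_instance
        epi_g := by dsimp [S]; infer_instance }
    have hΩ := ih S.X₁ (fun X i hi ↦ HomVanish.left_obj₁ hS.singleTriangle_distinguished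
      (homVanish_single_of_projective _ _ i (by lia)) (hM X (i + 1) (by lia)))
    obtain ⟨j, rfl⟩ : ∃ j, i = j + 1 := ⟨i - 1, by lia⟩
    exact HomVanish.left_obj₃ hS.singleTriangle_distinguished
      (homVanish_single_of_projective _ _ _ (by lia)) (hΩ j (by lia))

end Abelian

section Homology

open DerivedCategory

variable {C : Type*} [Category* C] [Abelian C] [HasDerivedCategory C]

lemma comp_homologyπ_eq_zero_of_homVanish (P : C) (K : CochainComplex C ℤ) (i : ℤ)
    (h : HomVanish ((singleFunctor C 0).obj P) (Q.obj K) i) (f : P ⟶ K.cycles i) :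
    f ≫ K.homologyπ i = 0 := by
  let g : (HomologicalComplex.single C (.up ℤ) i).obj P ⟶ K :=
    HomologicalComplex.mkHomFromSingle (f ≫ K.iCycles i) (by simp)
  have hg : Q.map g = 0 := by
    let e : (singleFunctor C i).obj P ≅
      Q.obj ((HomologicalComplex.single C (.up ℤ) i).obj P) := (singleFunctorIsoCompQ C i).app P
    let e₂ : ((singleFunctor C i).obj P)⟦i⟧ ≅ (singleFunctor C 0).obj P :=
      ((singleFunctors C).shiftIso i 0 i (by simp)).app P
    have := h (e₂.inv ≫ (e.hom ≫ Q.map g)⟦i⟧')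
    have h0 : (e.hom ≫ Q.map g)⟦i⟧' = 0 := by
      rw [← cancel_epi e₂.inv, this, comp_zero]
    have h1 : e.hom ≫ Q.map g = 0 :=
      (shiftFunctor (DerivedCategory C) i).map_injective (by simpa using h0)
    rw [← cancel_epi e.hom, h1, comp_zero]
  have hg' : HomologicalComplex.homologyMap g i = 0 := by
    have hnat : (homologyFunctor C i).map (Q.map g) ≫ (homologyFunctorFactors C i).hom.app K =
      (homologyFunctorFactors C i).hom.app _ ≫ HomologicalComplex.homologyMap g i :=
        (homologyFunctorFactors C i).hom.naturality g
    have h0 : (homologyFunctor C i).map (Q.map g) = 0 := by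
      rw [hg]
      exact Functor.map_zero _ _ _
    refine (cancel_epi ((homologyFunctorFactors C i).hom.app _)).1 (hnat.symm.trans ?_)
    rw [h0, zero_comp]
    exact comp_zero.symm
  have hc : (HomologicalComplex.singleObjCyclesSelfIso (.up ℤ) i P).inv ≫
      HomologicalComplex.cyclesMap g i = f := by
    rw [← cancel_mono (K.iCycles i)]
    simp [g]
  rw [← hc, Category.assoc, ← HomologicalComplex.homologyπ_naturality, hg', comp_zero, comp_zero]

end Homology

section HeartHomology

variable {R : Type u} [Ring R] [HasDerivedCategory.{w} (ModuleCat.{u} R)]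

open DerivedCategory

lemma isLE_zero_of_homVanish (X : DerivedCategory (ModuleCat.{u} R))
    (h : ∀ i : ℤ, 0 < i →
      HomVanish ((singleFunctor (ModuleCat.{u} R) 0).obj (ModuleCat.of R R)) X i) : X.IsLE 0 := by
  rw [DerivedCategory.isLE_iff]
  intro i hi
  let K := Q.objPreimage X
  let e : Q.obj K ≅ X := Q.objObjPreimageIso X
  let e' : (homologyFunctor (ModuleCat.{u} R) i).obj X ≅ K.homology i :=
    (homologyFunctor (ModuleCat.{u} R) i).mapIso e.symm ≪≫
    (homologyFunctorFactors (ModuleCat.{u} R) i).app K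
  refine IsZero.of_iso ?_ e'
  have : K.homologyπ i = 0 := by
    ext x
    have := comp_homologyπ_eq_zero_of_homVanish (ModuleCat.of R R) K i
      ((h i hi).of_iso (Iso.refl _) e.symm) (ModuleCat.ofHom (LinearMap.toSpanSingleton R _ x))
    have h1 : K.homologyπ i ((1 : R) • x) = 0 := congr($this (1 : R))
    rwa [one_smul] at h1
  exact IsZero.of_epi_eq_zero _ this

end HeartHomology

section TiltingFacts

open DerivedCategory

variable {R : Type u} [Ring R]

/-- The module `κ →₀ T` is the coproduct of `κ` copies of `T`. -/
def finsuppIsColimit (κ T : Type u) [AddCommGroup T] [Module R T] :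
    IsColimit (Cofan.mk (ModuleCat.of R (κ →₀ T))
      (fun k ↦ ModuleCat.ofHom (Finsupp.lsingle k)) : Cofan fun _ : κ ↦ ModuleCat.of R T) :=
  Cofan.IsColimit.mk _ (fun s ↦ ModuleCat.ofHom (Finsupp.lsum ℤ fun k ↦ (s.inj k).hom))
    (fun s k ↦ by ext x; simp) (fun s m hm ↦ by
      ext : 1
      refine Finsupp.lhom_ext' fun k ↦ ?_
      have := congr(($(hm k)).hom)
      ext x
      simpa using congr($this x))

lemma exists_tilting_coresolution {n : ℕ} {T : Type u} [AddCommGroup T] [Module R T]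
    (hT : IsNTilting R n T) : ∃ (K U : ℕ → ModuleCat.{u} R) (a : ∀ i, K i ⟶ U i)
      (b : ∀ i, U i ⟶ K (i + 1)) (w : ∀ i, a i ≫ b i = 0),
      (∀ i, (ShortComplex.mk _ _ (w i)).ShortExact) ∧ (∀ i, MemAddT R T (U i)) ∧
      Nonempty (ModuleCat.of R R ≅ K 0) ∧ ∃ r, ∀ i, r < i → IsZero (K i) := by
  obtain ⟨-, -, U, ε, d, hU, hε, hε', hd, r, hr⟩ := hT
  have hdd (i) : LinearMap.range (d i).hom ≤ LinearMap.ker (d (i + 1)).hom := by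
    rintro _ ⟨x, rfl⟩
    exact (hd i _).2 ⟨x, rfl⟩
  refine ⟨fun i ↦ ModuleCat.of R (LinearMap.ker (d i).hom), U,
    fun i ↦ ModuleCat.ofHom (LinearMap.ker (d i).hom).subtype,
    fun i ↦ ModuleCat.ofHom ((d i).hom.codRestrict _ fun x ↦ hdd i ⟨x, rfl⟩), ?_, ?_, hU, ?_, r, ?_⟩
  · intro i
    ext x
    exact x.2
  · intro i
    refine ModuleCat.shortComplex_shortExact _ ?_ ?_ ?_
    · intro x
      constructor
      · intro hx
        exact ⟨⟨x, congr(($hx).1)⟩, rfl⟩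
      · rintro ⟨x, rfl⟩
        exact Subtype.ext x.2
    · exact Subtype.val_injective
    · rintro ⟨x, hx⟩
      obtain ⟨y, rfl⟩ := (hd i _).1 hx
      exact ⟨y, rfl⟩
  · refine ⟨(LinearEquiv.ofBijective (ε.hom.codRestrict (LinearMap.ker (d 0).hom)
      fun x ↦ (hε' _).2 ⟨x, rfl⟩) ⟨?_, ?_⟩).toModuleIso⟩
    · intro x y hxy
      exact hε congr(($hxy).1)
    · rintro ⟨x, hx⟩
      obtain ⟨y, rfl⟩ := (hε' _).1 hx
      exact ⟨y, rfl⟩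
  · intro i hi
    have := hr i hi
    rw [ModuleCat.isZero_iff_subsingleton]
    infer_instance

variable [HasDerivedCategory.{w} (ModuleCat.{u} R)]

/-- The stalk complex of `κ →₀ T` is the coproduct of `κ` copies of the stalk complex of `T`. -/
lemma nonempty_isColimit_single_finsupp (κ T : Type u) [AddCommGroup T] [Module R T] :
    Nonempty (IsColimit (Cofan.mk ((singleFunctor _ 0).obj (ModuleCat.of R (κ →₀ T)))
      (fun k ↦ (singleFunctor _ 0).map (ModuleCat.ofHom (Finsupp.lsingle k))) :
        Cofan fun _ : κ ↦ singleT R T)) := by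
  have := preservesColimitsOfShape_singleFunctor (C := ModuleCat.{u} R) (ι := κ) 0
  exact ⟨Cofan.isColimitMapCoconeEquiv _ _ _
    (isColimitOfPreserves (singleFunctor (ModuleCat.{u} R) 0) (finsuppIsColimit κ T))⟩

variable {T : Type u} [AddCommGroup T] [Module R T]

lemma homVanish_finsupp {X : DerivedCategory (ModuleCat.{u} R)} {i : ℤ}
    (h : HomVanish (singleT R T) X i) (κ : Type u) :
    HomVanish ((singleFunctor _ 0).obj (ModuleCat.of R (κ →₀ T))) X i := fun f ↦ by
  obtain ⟨hc⟩ := nonempty_isColimit_single_finsupp (R := R) κ T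
  exact Cofan.IsColimit.hom_ext hc _ _ fun k ↦ (h _).trans comp_zero.symm

lemma homVanish_of_memAddT {X : DerivedCategory (ModuleCat.{u} R)} {i : ℤ}
    (h : HomVanish (singleT R T) X i) (U : ModuleCat.{u} R) (hU : MemAddT R T U) :
    HomVanish ((singleFunctor _ 0).obj U) X i := fun f ↦ by
  obtain ⟨κ, s, p, hps⟩ := hU
  have h0 : (singleFunctor _ 0).map (ModuleCat.ofHom s) ≫
      (singleFunctor _ 0).map (ModuleCat.ofHom p) = 𝟙 _ := by
    rw [← Functor.map_comp, ← ModuleCat.ofHom_comp, hps]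
    exact CategoryTheory.Functor.map_id _ _
  rw [← Category.id_comp f, ← h0, Category.assoc]
  exact eq_zero_of_fac_right rfl (homVanish_finsupp h κ _)

lemma homVanish_coresolution {K U : ℕ → ModuleCat.{u} R} {a : ∀ i, K i ⟶ U i}
    {b : ∀ i, U i ⟶ K (i + 1)} {w : ∀ i, a i ≫ b i = 0}
    (hS : ∀ i, (ShortComplex.mk _ _ (w i)).ShortExact) (hU : ∀ i, MemAddT R T (U i))
    {r : ℕ} (hr : ∀ i, r < i → IsZero (K i)) {X : DerivedCategory (ModuleCat.{u} R)}
    (hX : ∀ j : ℤ, 0 < j → HomVanish (singleT R T) X j) (i : ℕ) :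
    ∀ j : ℤ, 0 < j → HomVanish ((singleFunctor _ 0).obj (K i)) X j := by
  obtain ⟨m, hm⟩ : ∃ m, r < i + m := ⟨r + 1, by lia⟩
  induction m generalizing i with
  | zero =>
    intro j _ f
    exact ((singleFunctor (ModuleCat.{u} R) 0).map_isZero (hr i hm)).eq_of_src _ _
  | succ m ih =>
    intro j hj
    exact HomVanish.left_obj₁ (hS i).singleTriangle_distinguished
      (homVanish_of_memAddT (hX j hj) _ (hU i)) (ih (i + 1) (by lia) _ (by lia))

lemma isLE_zero_of_inHeart {n : ℕ} (hT : IsNTilting R n T) (X : DerivedCategory (ModuleCat.{u} R))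
    (hX : ∀ j : ℤ, 0 < j → HomVanish (singleT R T) X j) : X.IsLE 0 := by
  obtain ⟨K, U, a, b, w, hS, hU, ⟨e⟩, r, hr⟩ := exists_tilting_coresolution hT
  exact isLE_zero_of_homVanish X fun i hi ↦
    (homVanish_coresolution hS hU hr hX 0 i hi).of_iso ((singleFunctor _ 0).mapIso e) (Iso.refl _)

lemma homVanish_of_isLE {n : ℕ} (hT : IsNTilting R n T) (X : DerivedCategory (ModuleCat.{u} R))
    [X.IsLE 0] (i : ℤ) (hi : n < i) : HomVanish (singleT R T) X i := by
  refine homVanish_single_of_isLE n _ (fun Y i hi ↦ ?_) X i hi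
  obtain ⟨i, rfl⟩ := Int.eq_ofNat_of_zero_le (show 0 ≤ i by lia)
  exact (extVanish_iff_homVanish _ _ _ (by lia)).1 (hT.1 Y i (by lia))

lemma inHeart_single_iff (N : ModuleCat.{u} R) :
    InHeart (singleT R T) ((singleFunctor _ 0).obj N) ↔ InTPerp R T N := by
  constructor
  · intro h i hi
    exact (extVanish_iff_homVanish _ _ _ hi).2 (h i (by lia))
  · intro h i hi
    rcases hi.lt_or_gt with hi | hi
    · exact homVanish_single_of_neg _ _ _ hi
    · obtain ⟨i, rfl⟩ := Int.eq_ofNat_of_zero_le hi.le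
      exact (extVanish_iff_homVanish _ _ _ (by lia)).1 (h i (by lia))

lemma inHeart_finsupp {n : ℕ} (hT : IsNTilting R n T) (κ : Type u) :
    InHeart (singleT R T) ((singleFunctor _ 0).obj (ModuleCat.of R (κ →₀ T))) :=
  (inHeart_single_iff _).2 fun i hi ↦ hT.2.1 κ i hi

/-- Morphisms from a stalk complex form a small set. -/
lemma exists_surjective_singleT (X : DerivedCategory (ModuleCat.{u} R)) :
    ∃ (κ : Type u) (φ : κ → (singleT R T ⟶ X)), Function.Surjective φ := by
  let P := projectiveResolution (ModuleCat.of R T)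
  let K := Q.objPreimage X
  let e : Q.obj K ≅ X := Q.objObjPreimageIso X
  let e' : Q.obj P.cochainComplex ≅ singleT R T :=
    asIso (Q.map P.π') ≪≫ ((singleFunctorIsoCompQ _ 0).app _).symm
  refine ⟨P.cochainComplex ⟶ K, fun f ↦ e'.inv ≫ Q.map f ≫ e.hom, fun g ↦ ?_⟩
  obtain ⟨f, hf⟩ := exists_Q_map_eq (e'.hom ≫ g ≫ e.inv)
  exact ⟨f, by simp [hf]⟩

/-- Every object of the heart is covered by a sum of copies of `T`. -/
lemma exists_cover {n : ℕ} (hT : IsNTilting R n T) {X : DerivedCategory (ModuleCat.{u} R)}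
    (hX : InHeart (singleT R T) X) : ∃ (κ : Type u) (Y : DerivedCategory (ModuleCat.{u} R))
      (v : Y ⟶ (singleFunctor _ 0).obj (ModuleCat.of R (κ →₀ T)))
      (p : (singleFunctor _ 0).obj (ModuleCat.of R (κ →₀ T)) ⟶ X) (δ : X ⟶ Y⟦(1 : ℤ)⟧),
      Triangle.mk v p δ ∈ distTriang _ ∧ InHeart (singleT R T) Y := by
  obtain ⟨κ, φ, hφ⟩ := exists_surjective_singleT (T := T) X
  obtain ⟨hc⟩ := nonempty_isColimit_single_finsupp (R := R) κ T
  let p := Cofan.IsColimit.desc hc φ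
  have hp (f : singleT R T ⟶ X) : ∃ g, f = g ≫ p := by
    obtain ⟨k, rfl⟩ := hφ f
    exact ⟨_, (Cofan.IsColimit.fac hc φ k).symm⟩
  obtain ⟨Y, v, δ, hd⟩ := distinguished_cocone_triangle₁ p
  refine ⟨κ, Y, v, p, δ, hd, fun i hi ↦ ?_⟩
  obtain ⟨i, rfl⟩ : ∃ j, i = j + 1 := ⟨i - 1, by lia⟩
  by_cases hi' : i = 0
  · subst hi'
    intro f
    obtain ⟨g, hg⟩ : ∃ g : singleT R T ⟶ X, f = g ≫ δ :=
      Triangle.coyoneda_exact₁ _ hd f (inHeart_finsupp hT κ 1 (by lia) _)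
    obtain ⟨g, rfl⟩ := hp g
    rw [hg, Category.assoc]
    exact eq_zero_of_fac_right rfl (comp_distTriang_mor_zero₂₃ _ hd)
  · exact HomVanish.obj₁ hd (hX i hi') (inHeart_finsupp hT κ _ hi)

end TiltingFacts

section DirectSums

variable {R : Type u} [Ring R] {ι : Type u}

lemma ofHom_lmap_comp {A B C : ι → ModuleCat.{u} R} (f : ∀ i, A i ⟶ B i) (g : ∀ i, B i ⟶ C i) :
    ModuleCat.ofHom (lmap fun i ↦ (f i).hom) ≫ ModuleCat.ofHom (lmap fun i ↦ (g i).hom) =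
      ModuleCat.ofHom (lmap fun i ↦ (f i ≫ g i).hom) := by
  ext : 1
  exact (lmap_comp _ _).symm

/-- The direct sum of a family of short complexes of modules. -/
abbrev directSumShortComplex (S : ι → ShortComplex (ModuleCat.{u} R)) :
    ShortComplex (ModuleCat.{u} R) :=
  ShortComplex.mk (ModuleCat.ofHom (lmap fun i ↦ (S i).f.hom))
    (ModuleCat.ofHom (lmap fun i ↦ (S i).g.hom)) (by
      rw [ofHom_lmap_comp]
      ext : 1
      refine LinearMap.ext fun x ↦ DFinsupp.ext fun i ↦ ?_
      exact congr($((S i).zero) (x i)))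

lemma directSum_shortExact {S : ι → ShortComplex (ModuleCat.{u} R)} (hS : ∀ i, (S i).ShortExact) :
    (directSumShortComplex S).ShortExact := by
  refine ModuleCat.shortComplex_shortExact _ ?_ ?_ ?_
  · change Function.Exact (lmap fun i ↦ (S i).f.hom) (lmap fun i ↦ (S i).g.hom)
    have hr (i) : LinearMap.ker (S i).g.hom = LinearMap.range (S i).f.hom :=
      (hS i).exact.moduleCat_range_eq_ker.symm
    rw [LinearMap.exact_iff, ker_lmap, range_lmap]
    simp only [hr]
  · exact (lmap_injective _).2 fun i ↦ (hS i).moduleCat_injective_f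
  · exact (lmap_surjective _).2 fun i ↦ (hS i).moduleCat_surjective_g

end DirectSums

section ExtOne

variable {R : Type u} [Ring R] [HasDerivedCategory.{w} (ModuleCat.{u} R)]
  {T : ModuleCat.{u} R} {S : ShortComplex (ModuleCat.{u} R)}

open DerivedCategory

lemma exists_lift_of_extVanish_one (hS : S.ShortExact) (h : ExtVanish R 1 T S.X₁) (f : T ⟶ S.X₃) :
    ∃ g : T ⟶ S.X₂, g ≫ S.g = f := by
  obtain ⟨g, hg⟩ : ∃ g : (singleFunctor (ModuleCat.{u} R) 0).obj T ⟶ (singleFunctor _ 0).obj S.X₂,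
    (singleFunctor _ 0).map f = g ≫ (singleFunctor _ 0).map S.g :=
    Triangle.coyoneda_exact₃ _ hS.singleTriangle_distinguished ((singleFunctor _ 0).map f)
      ((extVanish_iff_homVanish _ _ 1 le_rfl).1 h _)
  obtain ⟨g, rfl⟩ := (singleFunctor (ModuleCat.{u} R) 0).map_surjective g
  exact ⟨g, (singleFunctor (ModuleCat.{u} R) 0).map_injective (by rw [hg, Functor.map_comp])⟩

lemma extVanish_one_of_exists_lift (hS : S.ShortExact) (h : ExtVanish R 1 T S.X₂)
    (hl : ∀ f : T ⟶ S.X₃, ∃ g : T ⟶ S.X₂, g ≫ S.g = f) : ExtVanish R 1 T S.X₁ := by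
  refine (extVanish_iff_homVanish _ _ 1 le_rfl).2 fun f ↦ ?_
  have hd := hS.singleTriangle_distinguished
  obtain ⟨g, hg⟩ : ∃ g : (singleFunctor (ModuleCat.{u} R) 0).obj T ⟶ (singleFunctor _ 0).obj S.X₃,
      f = g ≫ hS.singleδ :=
    Triangle.coyoneda_exact₁ _ hd f ((extVanish_iff_homVanish _ _ 1 le_rfl).1 h _)
  obtain ⟨g, rfl⟩ := (singleFunctor (ModuleCat.{u} R) 0).map_surjective g
  obtain ⟨g, rfl⟩ := hl g
  rw [hg, Functor.map_comp, Category.assoc]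
  exact eq_zero_of_fac_right rfl (comp_distTriang_mor_zero₂₃ _ hd)

end ExtOne

section ModuleLemma

variable {R : Type u} [Ring R] {T : ModuleCat.{u} R} {ι : Type u}

lemma exists_lift_lmap
    (hT : ∀ (N : ι → ModuleCat.{u} R), (∀ i, ExtVanish R 1 T (N i)) →
      ExtVanish R 1 T (ModuleCat.of R (⨁ i, (N i : Type u))))
    {A B C : ι → ModuleCat.{u} R} (v : ∀ i, A i ⟶ B i) (u : ∀ i, B i ⟶ C i)
    (w : ∀ i, v i ≫ u i = 0) (hA : ∀ i, ExtVanish R 1 T (A i))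
    (h : ∀ i (f : T ⟶ B i), f ≫ u i = 0 → ∃ g : T ⟶ A i, g ≫ v i = f)
    (f : T ⟶ ModuleCat.of R (⨁ i, B i))
    (hf : f ≫ ModuleCat.ofHom (lmap fun i ↦ (u i).hom) = 0) :
    ∃ g : T ⟶ ModuleCat.of R (⨁ i, A i), g ≫ ModuleCat.ofHom (lmap fun i ↦ (v i).hom) = f := by
  let := HasDerivedCategory.standard (ModuleCat.{u} R)
  let S (i : ι) : ShortComplex (ModuleCat.{u} R) :=
    ShortComplex.mk (kernel.ι (v i)) (factorThruImage (v i)) (by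
      rw [← cancel_mono (image.ι (v i))]; simp)
  have hS (i) : (S i).ShortExact :=
    { exact := ShortComplex.exact_of_f_is_kernel _
        (isKernelOfComp (image.ι (v i)) _ (kernelIsKernel (v i)) _ (image.fac (v i)))
      mono_f := by dsimp [S]; infer_instance
      epi_g := by dsimp [S]; infer_instance }
  let S' (i : ι) : ShortComplex (ModuleCat.{u} R) :=
    ShortComplex.mk (image.ι (v i)) (cokernel.π (image.ι (v i))) (by simp)
  have hS' (i) : (S' i).ShortExact :=
    { exact := ShortComplex.exact_cokernel _
      mono_f := by dsimp [S']; infer_instance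
      epi_g := by dsimp [S']; infer_instance }
  have hK (i) : ExtVanish R 1 T (S i).X₁ := by
    refine extVanish_one_of_exists_lift (hS i) (hA i) fun f ↦ ?_
    obtain ⟨g, hg⟩ := h i (f ≫ image.ι (v i)) (by
      have : image.ι (v i) ≫ u i = 0 := by
        rw [← cancel_epi (factorThruImage (v i))]
        simp [w]
      rw [Category.assoc, this, comp_zero])
    refine ⟨g, ?_⟩
    rw [← cancel_mono (image.ι (v i))]
    simpa [S] using hg
  have hf' : f ≫ ModuleCat.ofHom (lmap fun i ↦ (S' i).g.hom) = 0 := by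
    ext : 1
    refine LinearMap.ext fun x ↦ DFinsupp.ext fun i ↦ ?_
    obtain ⟨g, hg⟩ := h i (f ≫ ModuleCat.ofHom (DirectSum.component R ι _ i)) (by
      ext x
      exact congr($hf x i))
    have h0 : g ≫ v i ≫ cokernel.π (image.ι (v i)) = 0 := by
      rw [← image.fac_assoc (v i), cokernel.condition, comp_zero, comp_zero]
    rw [reassoc_of% hg] at h0
    exact congr($h0 x)
  obtain ⟨f', rfl⟩ := KernelFork.IsLimit.lift' (directSum_shortExact hS').fIsKernel f hf'
  obtain ⟨g, rfl⟩ := exists_lift_of_extVanish_one (directSum_shortExact hS) (hT _ hK) f'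
  refine ⟨g, ?_⟩
  have : ModuleCat.ofHom (lmap fun i ↦ (v i).hom) = (directSumShortComplex S).g ≫
      (directSumShortComplex S').f := by
    dsimp only
    rw [ofHom_lmap_comp]
    simp [S, S']
  exact this ▸ (Category.assoc _ _ _).symm

end ModuleLemma

section SigmaSingle

open DerivedCategory

variable {R : Type u} [Ring R] [HasDerivedCategory.{w} (ModuleCat.{u} R)] {ι : Type u}
  [HasColimitsOfShape (Discrete ι) (DerivedCategory (ModuleCat.{u} R))]

/-- Stalk complexes commute with coproducts, naturally. -/
lemma exists_sigma_single_iso :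
    ∃ e : ∀ Z : ι → ModuleCat.{u} R, (∐ fun j ↦ (singleFunctor _ 0).obj (Z j)) ≅
      (singleFunctor _ 0).obj (ModuleCat.of R (⨁ j, Z j)),
    ∀ (Z Z' : ι → ModuleCat.{u} R) (u : ∀ j, Z j ⟶ Z' j),
      (Limits.Sigma.map fun j ↦ (singleFunctor _ 0).map (u j)) ≫ (e Z').hom =
        (e Z).hom ≫ (singleFunctor _ 0).map (ModuleCat.ofHom (lmap fun j ↦ (u j).hom)) := by
  classical
  have := preservesColimitsOfShape_singleFunctor (C := ModuleCat.{u} R) (ι := ι) 0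
  have hc (Z : ι → ModuleCat.{u} R) :
      IsColimit (Cofan.mk ((singleFunctor _ 0).obj (ModuleCat.of R (⨁ j, Z j)))
        (fun j ↦ (singleFunctor _ 0).map (ModuleCat.ofHom (lof R ι (fun j ↦ Z j) j))) :
          Cofan fun j ↦ (singleFunctor _ 0).obj (Z j)) :=
    Cofan.isColimitMapCoconeEquiv _ _ _ (isColimitOfPreserves (singleFunctor (ModuleCat.{u} R) 0)
      (ModuleCat.coproductCoconeIsColimit Z))
  let e (Z : ι → ModuleCat.{u} R) := (coproductIsCoproduct _).coconePointUniqueUpToIso (hc Z)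
  have he (Z) (j) : Sigma.ι (fun j ↦ (singleFunctor _ 0).obj (Z j)) j ≫ (e Z).hom =
      (singleFunctor _ 0).map (ModuleCat.ofHom (lof R ι (fun j ↦ Z j) j)) :=
    (coproductIsCoproduct _).comp_coconePointUniqueUpToIso_hom (hc Z) ⟨j⟩
  refine ⟨e, fun Z Z' u ↦ ?_⟩
  ext j
  rw [Limits.Sigma.ι_map_assoc, he, reassoc_of% (he Z j), ← Functor.map_comp, ← Functor.map_comp]
  congr 1
  ext x : 2
  exact (lmap_lof (fun j ↦ (u j).hom) j x).symm

variable {T : ModuleCat.{u} R}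

lemma exists_lift_sigma
    (hT : ∀ (N : ι → ModuleCat.{u} R), (∀ i, ExtVanish R 1 T (N i)) →
      ExtVanish R 1 T (ModuleCat.of R (⨁ i, (N i : Type u))))
    {A B C : ι → ModuleCat.{u} R} (v : ∀ i, A i ⟶ B i) (u : ∀ i, B i ⟶ C i)
    (w : ∀ i, v i ≫ u i = 0) (hA : ∀ i, ExtVanish R 1 T (A i))
    (h : ∀ i (f : T ⟶ B i), f ≫ u i = 0 → ∃ g : T ⟶ A i, g ≫ v i = f)
    (f : (singleFunctor _ 0).obj T ⟶ ∐ fun j ↦ (singleFunctor _ 0).obj (B j))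
    (hf : f ≫ (Limits.Sigma.map fun j ↦ (singleFunctor _ 0).map (u j)) = 0) :
    ∃ g : (singleFunctor _ 0).obj T ⟶ ∐ fun j ↦ (singleFunctor _ 0).obj (A j),
      g ≫ (Limits.Sigma.map fun j ↦ (singleFunctor _ 0).map (v j)) = f := by
  obtain ⟨e, he⟩ := exists_sigma_single_iso (R := R) (ι := ι)
  obtain ⟨f', hf'⟩ := (singleFunctor (ModuleCat.{u} R) 0).map_surjective (f ≫ (e B).hom)
  obtain ⟨g, hg⟩ := exists_lift_lmap hT v u w hA h f'
    ((singleFunctor (ModuleCat.{u} R) 0).map_injective (by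
      rw [Functor.map_comp, hf', Category.assoc, ← he, reassoc_of% hf, zero_comp]
      exact (Functor.map_zero _ _ _).symm))
  refine ⟨(singleFunctor _ 0).map g ≫ (e A).inv, ?_⟩
  rw [← cancel_mono (e B).hom, ← hf', ← hg, Category.assoc, Category.assoc, he,
    Iso.inv_hom_id_assoc, Functor.map_comp]

end SigmaSingle

section Heart

open DerivedCategory

variable {R : Type u} [Ring R] [HasDerivedCategory.{w} (ModuleCat.{u} R)] {ι : Type u}
  [HasColimitsOfShape (Discrete ι) (DerivedCategory (ModuleCat.{u} R))]
  {T : Type u} [AddCommGroup T] [Module R T]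

lemma inHeart_sigma_finsupp {n : ℕ} (hT : IsNTilting R n T) (κ : ι → Type u) :
    InHeart (singleT R T) (∐ fun j ↦ (singleFunctor _ 0).obj (ModuleCat.of R (κ j →₀ T))) := by
  classical
  obtain ⟨e, -⟩ := exists_sigma_single_iso (R := R) (ι := ι)
  let E : ((Σ j, κ j) →₀ T) ≃ₗ[R] ⨁ j, (κ j →₀ T) := sigmaFinsuppLequivDFinsupp R
  exact (inHeart_finsupp hT (Σ j, κ j)).of_iso
    ((singleFunctor _ 0).mapIso E.toModuleIso ≪≫ (e fun j ↦ ModuleCat.of R (κ j →₀ T)).symm)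

lemma homVanish_sigma_of_pos {n : ℕ} (hT : IsNTilting R n T)
    {X : ι → DerivedCategory (ModuleCat.{u} R)} (hX : ∀ j, InHeart (singleT R T) (X j)) (i : ℤ)
    (hi : 0 < i) : HomVanish (singleT R T) (∐ X) i := by
  obtain ⟨m, hm⟩ : ∃ m : ℕ, n < i + m := ⟨n + 1, by lia⟩
  induction m generalizing i X with
  | zero =>
    have : (∐ X).IsLE 0 := isLE_coproduct 0
      (fun j ↦ isLE_zero_of_inHeart hT (X j) fun i hi ↦ hX j i hi.ne')
      (coproductIsCoproduct X)
    exact homVanish_of_isLE hT _ i (by simpa using hm)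
  | succ m ih =>
    choose κ Y v p δ hd hY using fun j ↦ exists_cover hT (hX j)
    obtain ⟨h, hd'⟩ := exists_sigma_distinguished v p δ hd
    exact HomVanish.obj₃ hd' (inHeart_sigma_finsupp hT κ i hi.ne')
      (ih hY (i + 1) (by lia) (by push_cast at hm; lia))

lemma inHeart_sigma {n : ℕ} (hT : IsNTilting R n T)
    (hN : ∀ (N : ι → ModuleCat.{u} R), (∀ i, ExtVanish R 1 (ModuleCat.of R T) (N i)) →
      ExtVanish R 1 (ModuleCat.of R T) (ModuleCat.of R (⨁ i, (N i : Type u))))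
    {X : ι → DerivedCategory (ModuleCat.{u} R)} (hX : ∀ j, InHeart (singleT R T) (X j)) :
    InHeart (singleT R T) (∐ X) := by
  have hneg {X : ι → DerivedCategory (ModuleCat.{u} R)} (hX : ∀ j, InHeart (singleT R T) (X j)) :
      HomVanish (singleT R T) (∐ X) (-1) := by
    choose κ Y v p δ hd hY using fun j ↦ exists_cover hT (hX j)
    choose κ₁ Y₁ v₁ p₁ δ₁ hd₁ hY₁ using fun j ↦ exists_cover hT (hY j)
    choose κ₂ Y₂ v₂ p₂ δ₂ hd₂ hY₂ using fun j ↦ exists_cover hT (hY₁ j)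
    obtain ⟨h, hd'⟩ := exists_sigma_distinguished v p δ hd
    obtain ⟨h₁, hd₁'⟩ := exists_sigma_distinguished v₁ p₁ δ₁ hd₁
    choose b hb using fun j ↦ (singleFunctor (ModuleCat.{u} R) 0).map_surjective (p₁ j ≫ v j)
    choose a ha using fun j ↦ (singleFunctor (ModuleCat.{u} R) 0).map_surjective (p₂ j ≫ v₁ j)
    have hvp (j) : v₁ j ≫ p₁ j = 0 := comp_distTriang_mor_zero₁₂ _ (hd₁ j)
    refine HomVanish.obj₃_neg_one hd' (inHeart_sigma_finsupp hT κ (-1) (by lia)) fun f hf ↦ ?_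
    obtain ⟨g, hg⟩ : ∃ g : (singleFunctor _ 0).obj (ModuleCat.of R T) ⟶ _,
        f = g ≫ Limits.Sigma.map p₁ :=
      Triangle.coyoneda_exact₃ _ hd₁' f (homVanish_sigma_of_pos hT hY₁ 1 (by lia) _)
    obtain ⟨k, hk⟩ := exists_lift_sigma hN a b
      (fun j ↦ (singleFunctor (ModuleCat.{u} R) 0).map_injective (by
        rw [Functor.map_comp, ha, hb, Category.assoc, reassoc_of% (hvp j), zero_comp, comp_zero]
        exact (Functor.map_zero _ _ _).symm))
      (fun j ↦ hT.2.1 (κ₂ j) 1 le_rfl)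
      (fun j φ hφ ↦ by
        have h0 : ((singleFunctor _ 0).map φ ≫ p₁ j) ≫ v j = 0 := by
          rw [Category.assoc, ← hb, ← Functor.map_comp, hφ]
          exact Functor.map_zero _ _ _
        replace h0 : (singleFunctor _ 0).map φ ≫ p₁ j = 0 :=
          comp_mor₁_eq_zero_imp (hd j) (hX j (-1) (by lia)) _ h0
        obtain ⟨k, hk⟩ : ∃ k : (singleFunctor _ 0).obj (ModuleCat.of R T) ⟶ Y₁ j,
            (singleFunctor _ 0).map φ = k ≫ v₁ j :=
          Triangle.coyoneda_exact₂ _ (hd₁ j) _ h0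
        obtain ⟨k', rfl⟩ : ∃ k' : (singleFunctor _ 0).obj (ModuleCat.of R T) ⟶
          (singleFunctor _ 0).obj _, k = k' ≫ p₂ j :=
          Triangle.coyoneda_exact₃ _ (hd₂ j) k (hY₂ j 1 (by lia) _)
        obtain ⟨ψ, rfl⟩ := (singleFunctor (ModuleCat.{u} R) 0).map_surjective k'
        refine ⟨ψ, (singleFunctor (ModuleCat.{u} R) 0).map_injective ?_⟩
        rw [hk, Functor.map_comp, ha, Category.assoc])
      g (by
        have : (Limits.Sigma.map fun j ↦ (singleFunctor _ 0).map (b j)) =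
            Limits.Sigma.map p₁ ≫ Limits.Sigma.map v := by
          ext j
          simp [hb]
        rw [this, ← Category.assoc, ← hg]
        exact hf)
    have h0 : (Limits.Sigma.map fun j ↦ (singleFunctor _ 0).map (a j)) ≫ Limits.Sigma.map p₁ =
        0 := by
      ext j
      simp [ha, reassoc_of% (hvp j)]
    rw [← hk, Category.assoc, h0, comp_zero] at hg
    exact hg
  intro i hi₀
  rcases hi₀.lt_or_gt with hi | hi
  · obtain ⟨m, hm⟩ : ∃ m : ℕ, i = -1 - m := ⟨(-1 - i).toNat, by lia⟩
    subst hm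
    clear hi hi₀
    induction m generalizing X with
    | zero => simpa using hneg hX
    | succ m ih =>
      choose κ Y v p δ hd hY using fun j ↦ exists_cover hT (hX j)
      obtain ⟨h, hd'⟩ := exists_sigma_distinguished v p δ hd
      refine HomVanish.obj₃ hd' (inHeart_sigma_finsupp hT κ _ (by lia)) ?_
      have e : (-1 - ((m + 1 : ℕ) : ℤ)) + 1 = -1 - m := by
        push_cast
        ring
      rw [e]
      exact ih hY
  · exact homVanish_sigma_of_pos hT hX i hi

end Heart

section Precover

open DerivedCategory

variable {R : Type u} [Ring R] {T : Type u} [AddCommGroup T] [Module R T]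

variable (T) in
/-- Every module has a precover by a sum of copies of `T`. -/
lemma exists_precover (N : ModuleCat.{u} R) :
    ∃ (κ : Type u) (p : ModuleCat.of R (κ →₀ T) ⟶ N),
      ∀ f : ModuleCat.of R T ⟶ N, ∃ g, g ≫ p = f := by
  let hc := finsuppIsColimit (R := R) (ModuleCat.of R T ⟶ N) T
  exact ⟨ModuleCat.of R T ⟶ N, Cofan.IsColimit.desc hc id,
    fun f ↦ ⟨_, Cofan.IsColimit.fac hc id f⟩⟩

lemma exists_lift_of_memAddT {V N : ModuleCat.{u} R} (p : V ⟶ N)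
    (hp : ∀ f : ModuleCat.of R T ⟶ N, ∃ g, g ≫ p = f) (U : ModuleCat.{u} R) (hU : MemAddT R T U)
    (f : U ⟶ N) : ∃ g, g ≫ p = f := by
  obtain ⟨κ, s, q, hqs⟩ := hU
  let hc := finsuppIsColimit (R := R) κ T
  choose g hg using fun k ↦ hp (ModuleCat.ofHom (Finsupp.lsingle k) ≫ ModuleCat.ofHom q ≫ f)
  have hs : ModuleCat.ofHom s ≫ ModuleCat.ofHom q = 𝟙 _ := by
    rw [← ModuleCat.ofHom_comp, hqs]
    rfl
  have h : Cofan.IsColimit.desc hc g ≫ p = ModuleCat.ofHom q ≫ f := by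
    refine Cofan.IsColimit.hom_ext hc _ _ fun k ↦ ?_
    have := Cofan.IsColimit.fac hc g k
    rw [reassoc_of% this]
    exact hg k
  refine ⟨ModuleCat.ofHom s ≫ Cofan.IsColimit.desc hc g, ?_⟩
  rw [Category.assoc, h, reassoc_of% hs]

variable [HasDerivedCategory.{w} (ModuleCat.{u} R)]

lemma exists_extension_of_homVanish {S : ShortComplex (ModuleCat.{u} R)} (hS : S.ShortExact)
    {V : ModuleCat.{u} R}
    (h : HomVanish ((singleFunctor _ 0).obj S.X₃) ((singleFunctor _ 0).obj V) 1) (f : S.X₁ ⟶ V) :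
    ∃ g, S.f ≫ g = f := by
  obtain ⟨g, hg⟩ : ∃ g : ((singleFunctor _ 0).obj S.X₂)⟦(1 : ℤ)⟧ ⟶
      ((singleFunctor (ModuleCat.{u} R) 0).obj V)⟦(1 : ℤ)⟧,
      ((singleFunctor _ 0).map f)⟦(1 : ℤ)⟧' = (-((singleFunctor _ 0).map S.f)⟦(1 : ℤ)⟧') ≫ g :=
    Triangle.yoneda_exact₃ _ (rot_of_distTriang _ hS.singleTriangle_distinguished)
      (((singleFunctor _ 0).map f)⟦(1 : ℤ)⟧') (h _)
  obtain ⟨g, rfl⟩ := (shiftFunctor (DerivedCategory (ModuleCat.{u} R)) (1 : ℤ)).map_surjective g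
  obtain ⟨g, rfl⟩ := (singleFunctor (ModuleCat.{u} R) 0).map_surjective g
  refine ⟨-g, (singleFunctor (ModuleCat.{u} R) 0).map_injective
    ((shiftFunctor (DerivedCategory (ModuleCat.{u} R)) (1 : ℤ)).map_injective ?_)⟩
  rw [hg]
  simp

lemma exists_lift_coresolution {K U : ℕ → ModuleCat.{u} R} {a : ∀ i, K i ⟶ U i}
    {b : ∀ i, U i ⟶ K (i + 1)} {w : ∀ i, a i ≫ b i = 0}
    (hS : ∀ i, (ShortComplex.mk _ _ (w i)).ShortExact) (hU : ∀ i, MemAddT R T (U i))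
    {r : ℕ} (hr : ∀ i, r < i → IsZero (K i))
    {N V : ℕ → ModuleCat.{u} R} {l : ∀ k, N (k + 1) ⟶ V k} {p : ∀ k, V k ⟶ N k}
    (hl : ∀ k (Z : ModuleCat.{u} R) (f : Z ⟶ V k), f ≫ p k = 0 → ∃ g, g ≫ l k = f)
    [∀ k, Mono (l k)] (hlp : ∀ k, l k ≫ p k = 0)
    (hp : ∀ k (f : ModuleCat.of R T ⟶ N k), ∃ g, g ≫ p k = f)
    (hV : ∀ k (j : ℤ), 0 < j → HomVanish (singleT R T) ((singleFunctor _ 0).obj (V k)) j)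
    (i k : ℕ) (hik : r < i + k) (f : K i ⟶ N k) : ∃ g, g ≫ p k = f := by
  obtain ⟨m, hm⟩ : ∃ m, r < i + m := ⟨r + 1, by lia⟩
  induction m generalizing i k with
  | zero => exact ⟨0, (hr i hm).eq_of_src _ _⟩
  | succ m ih =>
    by_cases hi : r < i
    · exact ⟨0, (hr i hi).eq_of_src _ _⟩
    obtain ⟨k, rfl⟩ : ∃ k', k = k' + 1 := ⟨k - 1, by lia⟩
    obtain ⟨g, hg⟩ := exists_extension_of_homVanish (hS i)
      (homVanish_coresolution hS hU hr (hV k) (i + 1) 1 (by lia)) (f ≫ l k)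
    dsimp only at g hg
    obtain ⟨t, ht⟩ : ∃ t, b i ≫ t = g ≫ p k := by
      have h0 : a i ≫ g ≫ p k = 0 := by
        rw [reassoc_of% hg, hlp, comp_zero]
      exact ⟨_, (CokernelCofork.IsColimit.desc' (hS i).gIsCokernel _ h0).2⟩
    obtain ⟨t', rfl⟩ := ih (i + 1) k (by lia) t (by lia)
    obtain ⟨s, hs⟩ := hl k _ (g - b i ≫ t') (by simp [ht])
    obtain ⟨s', rfl⟩ := exists_lift_of_memAddT (p (k + 1)) (hp _) (U i) (hU i) s
    refine ⟨a i ≫ s', ?_⟩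
    rw [← cancel_mono (l k), Category.assoc, Category.assoc, ← Category.assoc s', hs,
      Preadditive.comp_sub, hg, reassoc_of% (w i), zero_comp, sub_zero]

end Precover

section HeartCone

variable {C : Type*} [Category* C] [Preadditive C] [HasShift C ℤ]
  [∀ n : ℤ, (shiftFunctor C n).Additive] [HasZeroObject C] [Pretriangulated C]

lemma exists_inHeart_cone {T A V B X : C} {l : A ⟶ V} {p : V ⟶ B} (hlp : l ≫ p = 0)
    (hp : ∀ f : T ⟶ V, f ≫ p = 0 → ∃ g, g ≫ l = f) (hV : InHeart T V)
    (hl : ∀ f : T ⟶ A, f ≫ l = 0 → f = 0) (hX : InHeart T X) {φ : X ⟶ A}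
    (hφ : ∀ f : T ⟶ X, f ≫ φ = 0 → f = 0) (hφ' : ∀ f : T ⟶ A, ∃ g, g ≫ φ = f) :
    ∃ (X' : C) (q : V ⟶ X') (χ : X' ⟶ B) (δ' : X' ⟶ X⟦(1 : ℤ)⟧),
      Triangle.mk (φ ≫ l) q δ' ∈ distTriang C ∧ InHeart T X' ∧ q ≫ χ = p ∧
        ∀ f : T ⟶ X', f ≫ χ = 0 → f = 0 := by
  obtain ⟨X', q, δ', hd'⟩ := distinguished_cocone_triangle (φ ≫ l)
  have hq : (φ ≫ l) ≫ q = 0 := comp_distTriang_mor_zero₁₂ _ hd'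
  have h0 : (φ ≫ l) ≫ p = 0 := by rw [Category.assoc, hlp, comp_zero]
  obtain ⟨χ, hχ⟩ : ∃ χ : X' ⟶ B, p = q ≫ χ := Triangle.yoneda_exact₂ _ hd' p h0
  refine ⟨X', q, χ, δ', hd', InHeart.obj₃ hd' hX hV fun f hf ↦
    hφ _ (hl _ ((Category.assoc _ _ _).trans hf)), hχ.symm, fun f hf ↦ ?_⟩
  obtain ⟨g, rfl⟩ : ∃ g : T ⟶ V, f = g ≫ q :=
    Triangle.coyoneda_exact₃ _ hd' f (hX 1 (by lia) _)
  obtain ⟨h, rfl⟩ := hp g (by rwa [hχ, ← Category.assoc])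
  obtain ⟨h, rfl⟩ := hφ' h
  rw [Category.assoc h, Category.assoc h, hq, comp_zero]

end HeartCone

section Approximation

open DerivedCategory

variable {R : Type u} [Ring R] [HasDerivedCategory.{w} (ModuleCat.{u} R)]
  {T : Type u} [AddCommGroup T] [Module R T]

lemma eq_zero_of_comp_single_map {A B : ModuleCat.{u} R} (l : A ⟶ B) [Mono l]
    (f : singleT R T ⟶ (singleFunctor _ 0).obj A) (hf : f ≫ (singleFunctor _ 0).map l = 0) :
    f = 0 := by
  obtain ⟨f, rfl⟩ := (singleFunctor (ModuleCat.{u} R) 0).map_surjective f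
  have : f ≫ l = 0 := (singleFunctor (ModuleCat.{u} R) 0).map_injective (by
    rw [Functor.map_comp]
    exact hf.trans (Functor.map_zero _ _ _).symm)
  rw [zero_of_comp_mono l this]
  exact Functor.map_zero _ _ _

lemma exists_comp_single_map {A B : ModuleCat.{u} R} (p : A ⟶ B)
    (hp : ∀ f : ModuleCat.of R T ⟶ B, ∃ g, g ≫ p = f)
    (f : singleT R T ⟶ (singleFunctor _ 0).obj B) : ∃ g, g ≫ (singleFunctor _ 0).map p = f := by
  obtain ⟨f, rfl⟩ := (singleFunctor (ModuleCat.{u} R) 0).map_surjective f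
  obtain ⟨g, rfl⟩ := hp f
  exact ⟨(singleFunctor _ 0).map g, (Functor.map_comp _ _ _).symm⟩

lemma exists_heart_approximation {n : ℕ} (hT : IsNTilting R n T) (M : ModuleCat.{u} R) :
    ∃ (X : DerivedCategory (ModuleCat.{u} R)) (φ : X ⟶ (singleFunctor _ 0).obj M),
      InHeart (singleT R T) X ∧ (∀ f : singleT R T ⟶ X, f ≫ φ = 0 → f = 0) ∧
        ∀ f : singleT R T ⟶ (singleFunctor _ 0).obj M, ∃ g, g ≫ φ = f := by
  obtain ⟨K, U, a, b, w, hS, hU, ⟨e⟩, r, hr⟩ := exists_tilting_coresolution hT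
  choose κ p hp using exists_precover (R := R) T
  obtain ⟨N, rfl, l, hm, hlp, hE⟩ : ∃ N : ℕ → ModuleCat.{u} R, N 0 = M ∧
      ∃ l : ∀ k, N (k + 1) ⟶ ModuleCat.of R (κ (N k) →₀ T), (∀ k, Mono (l k)) ∧
        ∃ w : ∀ k, l k ≫ p (N k) = 0, ∀ k, (ShortComplex.mk _ _ (w k)).Exact :=
    ⟨fun k ↦ Nat.rec M (fun _ N ↦ kernel (p N)) k, rfl, fun k ↦ kernel.ι (p _),
      fun k ↦ inferInstanceAs (Mono (kernel.ι (p _))), fun k ↦ kernel.condition (p _),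
      fun k ↦ ShortComplex.exact_kernel (p _)⟩
  have hl (k) (Z : ModuleCat.{u} R) (f : Z ⟶ ModuleCat.of R (κ (N k) →₀ T))
      (hf : f ≫ p (N k) = 0) : ∃ g, g ≫ l k = f :=
    ⟨(KernelFork.IsLimit.lift' (hE k).fIsKernel f hf).1,
      (KernelFork.IsLimit.lift' (hE k).fIsKernel f hf).2⟩
  have hV (k) : InHeart (singleT R T) ((singleFunctor _ 0).obj (ModuleCat.of R (κ (N k) →₀ T))) :=
    inHeart_finsupp hT _
  have hlift (k) (i : ℕ) (hk : r < i + k) (f : K i ⟶ N k) : ∃ g, g ≫ p (N k) = f :=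
    exists_lift_coresolution hS hU hr hl hlp (fun k ↦ hp (N k)) (fun k j hj ↦ hV k j hj.ne')
      i k hk f
  have hNS (k) (hk : r < k) : (ShortComplex.mk _ _ (hlp k)).ShortExact :=
    { exact := hE k
      mono_f := hm k
      epi_g := by
        refine (ModuleCat.epi_iff_surjective _).2 fun x ↦ ?_
        obtain ⟨g, hg⟩ := hlift k 0 (by lia)
          (e.inv ≫ ModuleCat.ofHom (LinearMap.toSpanSingleton R (N k) x))
        refine ⟨(e.hom ≫ g) (1 : R), ?_⟩
        have : (e.hom ≫ g) ≫ p (N k) = ModuleCat.ofHom (LinearMap.toSpanSingleton R (N k) x) := by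
          rw [Category.assoc, hg, Iso.hom_inv_id_assoc]
        exact congr($this (1 : R)).trans (one_smul _ _) }
  have hpos (i k : ℕ) (hk : r + 2 + i ≤ k) :
      HomVanish (singleT R T) ((singleFunctor _ 0).obj (N k)) ((i : ℤ) + 1) := by
    induction i generalizing k with
    | zero =>
      obtain ⟨k, rfl⟩ : ∃ k', k = k' + 1 := ⟨k - 1, by lia⟩
      exact (extVanish_iff_homVanish _ _ 1 le_rfl).1
        (extVanish_one_of_exists_lift (hNS k (by lia)) (hT.2.1 _ 1 le_rfl) (hp (N k)))
    | succ i ih =>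
      obtain ⟨k, rfl⟩ : ∃ k', k = k' + 1 := ⟨k - 1, by lia⟩
      rw [Nat.cast_succ]
      exact HomVanish.obj₁ (hNS k (by lia)).singleTriangle_distinguished (ih k (by lia))
        (hV k _ (by lia))
  obtain ⟨m, hm⟩ : ∃ m, 0 + m = r + 2 + n := ⟨_, Nat.zero_add _⟩
  suffices ∀ k, k + m = r + 2 + n → ∃ (X : DerivedCategory (ModuleCat.{u} R))
      (φ : X ⟶ (singleFunctor _ 0).obj (N k)),
      InHeart (singleT R T) X ∧ (∀ f : singleT R T ⟶ X, f ≫ φ = 0 → f = 0) ∧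
        ∀ f : singleT R T ⟶ (singleFunctor _ 0).obj (N k), ∃ g, g ≫ φ = f from this 0 hm
  clear hm
  induction m with
  | zero =>
    rintro k rfl
    refine ⟨_, 𝟙 _, (inHeart_single_iff _).2 fun i hi ↦ ?_, fun f hf ↦ by simpa using hf,
      fun f ↦ ⟨f, Category.comp_id f⟩⟩
    by_cases hin : n < i
    · exact hT.1 _ i hin
    · obtain ⟨i, rfl⟩ : ∃ i', i = i' + 1 := ⟨i - 1, by lia⟩
      exact (extVanish_iff_homVanish _ _ _ hi).2 (hpos i _ (by lia))
  | succ m ih =>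
    intro k hk
    obtain ⟨X, φ, hX, hφ, hφ'⟩ := ih (k + 1) (by lia)
    obtain ⟨X', q, χ, -, -, hX', hχ, hχ'⟩ := exists_inHeart_cone
      (l := (singleFunctor _ 0).map (l k)) (p := (singleFunctor _ 0).map (p (N k)))
      (by
        rw [← Functor.map_comp, hlp]
        exact Functor.map_zero _ _ _)
      (fun f hf ↦ by
        obtain ⟨f, rfl⟩ := (singleFunctor (ModuleCat.{u} R) 0).map_surjective f
        have h0 : f ≫ p (N k) = 0 := (singleFunctor (ModuleCat.{u} R) 0).map_injective (by
          rw [Functor.map_comp]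
          exact hf.trans (Functor.map_zero _ _ _).symm)
        obtain ⟨g, rfl⟩ := hl k _ f h0
        exact ⟨(singleFunctor _ 0).map g, (Functor.map_comp _ _ _).symm⟩)
      (hV k) (fun f hf ↦ eq_zero_of_comp_single_map _ f hf) hX hφ hφ'
    refine ⟨X', χ, hX', hχ', fun f ↦ ?_⟩
    obtain ⟨g, rfl⟩ := exists_comp_single_map _ (hp (N k)) f
    exact ⟨g ≫ q, by rw [Category.assoc, hχ]⟩

end Approximation

section SigmaLift

variable {C : Type*} [Category* C] [Preadditive C] [HasShift C ℤ]
  [∀ n : ℤ, (shiftFunctor C n).Additive] [HasZeroObject C] [Pretriangulated C] {ι : Type*}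
  [HasColimitsOfShape (Discrete ι) C]

lemma exists_comp_sigma_map {T : C} {V B W X₀ X₁ X₂ X₃ I : ι → C} {v : ∀ j, V j ⟶ B j}
    {u : ∀ j, B j ⟶ W j} {a₀ : ∀ j, X₀ j ⟶ V j} {b₀ : ∀ j, V j ⟶ X₁ j}
    {δ₀ : ∀ j, X₁ j ⟶ (X₀ j)⟦(1 : ℤ)⟧} {a₁ : ∀ j, X₁ j ⟶ W j} {b₁ : ∀ j, W j ⟶ X₂ j}
    {δ₁ : ∀ j, X₂ j ⟶ (X₁ j)⟦(1 : ℤ)⟧} {a₂ : ∀ j, X₂ j ⟶ I j} {b₂ : ∀ j, I j ⟶ X₃ j}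
    {δ₂ : ∀ j, X₃ j ⟶ (X₂ j)⟦(1 : ℤ)⟧}
    (hd₀ : ∀ j, Triangle.mk (a₀ j) (b₀ j) (δ₀ j) ∈ distTriang C)
    (hd₁ : ∀ j, Triangle.mk (a₁ j) (b₁ j) (δ₁ j) ∈ distTriang C)
    (hd₂ : ∀ j, Triangle.mk (a₂ j) (b₂ j) (δ₂ j) ∈ distTriang C)
    (hX₀ : HomVanish T (∐ X₀) 1) (hX₃ : HomVanish T (∐ X₃) (-1))
    (h₁ : ∀ j, b₀ j ≫ a₁ j = v j ≫ u j) (h₂ : ∀ j, u j ≫ b₁ j ≫ a₂ j = 0) (g : T ⟶ ∐ B) :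
    ∃ h : T ⟶ ∐ V, h ≫ Limits.Sigma.map v ≫ Limits.Sigma.map u = g ≫ Limits.Sigma.map u := by
  obtain ⟨_, hd₀'⟩ := exists_sigma_distinguished a₀ b₀ δ₀ hd₀
  obtain ⟨_, hd₁'⟩ := exists_sigma_distinguished a₁ b₁ δ₁ hd₁
  obtain ⟨_, hd₂'⟩ := exists_sigma_distinguished a₂ b₂ δ₂ hd₂
  have hv : Limits.Sigma.map b₀ ≫ Limits.Sigma.map a₁ =
      Limits.Sigma.map v ≫ Limits.Sigma.map u := by
    ext j
    simp [reassoc_of% (h₁ j)]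
  have hu : Limits.Sigma.map u ≫ Limits.Sigma.map b₁ ≫ Limits.Sigma.map a₂ = 0 := by
    ext j
    simp [reassoc_of% (h₂ j)]
  have h0 : ((g ≫ Limits.Sigma.map u) ≫ Limits.Sigma.map b₁) ≫ Limits.Sigma.map a₂ = 0 := by
    rw [Category.assoc, Category.assoc, hu, comp_zero]
  obtain ⟨k, hk⟩ : ∃ k : T ⟶ ∐ X₁, g ≫ Limits.Sigma.map u = k ≫ Limits.Sigma.map a₁ :=
    Triangle.coyoneda_exact₂ _ hd₁' _ (comp_mor₁_eq_zero_imp hd₂' hX₃ _ h0)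
  obtain ⟨h, rfl⟩ : ∃ h : T ⟶ ∐ V, k = h ≫ Limits.Sigma.map b₀ :=
    Triangle.coyoneda_exact₃ _ hd₀' k (hX₀ _)
  exact ⟨h, by rw [hk, Category.assoc, hv]⟩

end SigmaLift

section InjectiveCoresolution

open DerivedCategory

variable {R : Type u} [Ring R]

/-- The embedding of `N` into an injective module, together with its cokernel. -/
abbrev injectiveShortComplex (N : ModuleCat.{u} R) : ShortComplex (ModuleCat.{u} R) :=
  ShortComplex.mk (Injective.ι N) (cokernel.π (Injective.ι N)) (cokernel.condition _)

lemma injectiveShortComplex_shortExact (N : ModuleCat.{u} R) :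
    (injectiveShortComplex N).ShortExact :=
  { exact := ShortComplex.exact_cokernel _
    mono_f := by dsimp; infer_instance
    epi_g := by dsimp; infer_instance }

variable [HasDerivedCategory.{w} (ModuleCat.{u} R)] {T : Type u} [AddCommGroup T] [Module R T]

lemma inHeart_single_of_injective (I : ModuleCat.{u} R) [Injective I] :
    InHeart (singleT R T) ((singleFunctor _ 0).obj I) :=
  (inHeart_single_iff I).2 fun i hi ↦ by
    obtain ⟨i, rfl⟩ : ∃ i', i = i' + 1 := ⟨i - 1, by lia⟩
    rw [extVanish_iff_subsingleton_ext]
    exact subsingleton_of_forall_eq 0 Abelian.Ext.eq_zero_of_injective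

lemma exists_inHeart_injective_cone {N : ModuleCat.{u} R} {X : DerivedCategory (ModuleCat.{u} R)}
    (hX : InHeart (singleT R T) X) {φ : X ⟶ (singleFunctor _ 0).obj N}
    (hφ : ∀ f : singleT R T ⟶ X, f ≫ φ = 0 → f = 0)
    (hφ' : ∀ f : singleT R T ⟶ (singleFunctor _ 0).obj N, ∃ g, g ≫ φ = f) :
    ∃ (X' : DerivedCategory (ModuleCat.{u} R))
      (q : (singleFunctor _ 0).obj (injectiveShortComplex N).X₂ ⟶ X')
      (χ : X' ⟶ (singleFunctor _ 0).obj (injectiveShortComplex N).X₃) (δ : X' ⟶ X⟦(1 : ℤ)⟧),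
      Triangle.mk (φ ≫ (singleFunctor _ 0).map (injectiveShortComplex N).f) q δ ∈ distTriang _ ∧
        InHeart (singleT R T) X' ∧ q ≫ χ = (singleFunctor _ 0).map (injectiveShortComplex N).g ∧
        ∀ f : singleT R T ⟶ X', f ≫ χ = 0 → f = 0 := by
  have hd := (injectiveShortComplex_shortExact N).singleTriangle_distinguished
  refine exists_inHeart_cone (comp_distTriang_mor_zero₁₂ _ hd)
    (fun f hf ↦ ?_) (inHeart_single_of_injective _) (fun f hf ↦ ?_) hX hφ hφ'
  · obtain ⟨g, hg⟩ := Triangle.coyoneda_exact₂ _ hd f hf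
    exact ⟨g, hg.symm⟩
  · exact eq_zero_of_comp_single_map (Injective.ι N) f hf

lemma exists_inHeart_coresolution {n : ℕ} (hT : IsNTilting R n T) {N : ModuleCat.{u} R}
    (hN : ExtVanish R 1 (ModuleCat.of R T) N) :
    ∃ (V B W : ModuleCat.{u} R) (i : N ⟶ V) (v : V ⟶ B) (u : B ⟶ W) (hiv : i ≫ v = 0)
      (X₀ X₁ X₂ X₃ I : DerivedCategory (ModuleCat.{u} R))
      (a₀ : X₀ ⟶ (singleFunctor _ 0).obj V) (b₀ : (singleFunctor _ 0).obj V ⟶ X₁)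
      (δ₀ : X₁ ⟶ X₀⟦(1 : ℤ)⟧)
      (a₁ : X₁ ⟶ (singleFunctor _ 0).obj W) (b₁ : (singleFunctor _ 0).obj W ⟶ X₂)
      (δ₁ : X₂ ⟶ X₁⟦(1 : ℤ)⟧) (a₂ : X₂ ⟶ I) (b₂ : I ⟶ X₃) (δ₂ : X₃ ⟶ X₂⟦(1 : ℤ)⟧),
      (ShortComplex.mk i v hiv).ShortExact ∧ Function.Injective u ∧
      InHeart (singleT R T) ((singleFunctor _ 0).obj V) ∧
      Triangle.mk a₀ b₀ δ₀ ∈ distTriang _ ∧ Triangle.mk a₁ b₁ δ₁ ∈ distTriang _ ∧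
      Triangle.mk a₂ b₂ δ₂ ∈ distTriang _ ∧ InHeart (singleT R T) X₀ ∧ InHeart (singleT R T) X₃ ∧
      b₀ ≫ a₁ = (singleFunctor _ 0).map v ≫ (singleFunctor _ 0).map u ∧
      (singleFunctor _ 0).map u ≫ b₁ ≫ a₂ = 0 := by
  obtain ⟨X₀, φ, hX₀, hφ, hφ'⟩ := exists_heart_approximation hT N
  obtain ⟨X₁, b₀, χ₁, δ₀, hd₀, hX₁, hbχ₁, hχ₁⟩ := exists_inHeart_injective_cone hX₀ hφ hφ'
  have hχ₁' (f : singleT R T ⟶ (singleFunctor _ 0).obj (injectiveShortComplex N).X₃) :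
      ∃ g, g ≫ χ₁ = f := by
    obtain ⟨g, rfl⟩ := exists_comp_single_map (injectiveShortComplex N).g
      (exists_lift_of_extVanish_one (injectiveShortComplex_shortExact N) hN) f
    exact ⟨g ≫ b₀, by rw [Category.assoc, hbχ₁]⟩
  obtain ⟨X₂, b₁, χ₂, δ₁, hd₁, hX₂, hbχ₂, hχ₂⟩ := exists_inHeart_injective_cone hX₁ hχ₁ hχ₁'
  let C := (injectiveShortComplex (injectiveShortComplex N).X₃).X₃
  obtain ⟨X₃, b₂, δ₂, hd₂⟩ := distinguished_cocone_triangle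
    (χ₂ ≫ (singleFunctor (ModuleCat.{u} R) 0).map (Injective.ι C))
  refine ⟨_, _, _, _, _, _, _, X₀, X₁, X₂, X₃, _, _, b₀, δ₀, _, b₁, δ₁, _, b₂, δ₂,
    injectiveShortComplex_shortExact N,
    (injectiveShortComplex_shortExact (injectiveShortComplex N).X₃).moduleCat_injective_f,
    inHeart_single_of_injective _, hd₀, hd₁, hd₂, hX₀, ?_, ?_, ?_⟩
  · refine InHeart.obj₃ hd₂ hX₂ (inHeart_single_of_injective (Injective.under C)) fun f hf ↦ ?_
    exact hχ₂ _ (eq_zero_of_comp_single_map (Injective.ι C) _ ((Category.assoc _ _ _).trans hf))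
  · rw [reassoc_of% hbχ₁]
  · rw [reassoc_of% hbχ₂, ← Functor.map_comp_assoc, ShortComplex.zero, Functor.map_zero, zero_comp]

lemma extVanish_one_directSum_of_exists_lift {T : ModuleCat.{u} R} {ι : Type u}
    {S : ι → ShortComplex (ModuleCat.{u} R)} (hS : ∀ j, (S j).ShortExact)
    (hV : ExtVanish R 1 T (ModuleCat.of R (⨁ j, (S j).X₂)))
    (hl : ∀ g : T ⟶ ModuleCat.of R (⨁ j, (S j).X₃), ∃ h : T ⟶ ModuleCat.of R (⨁ j, (S j).X₂),
      h ≫ ModuleCat.ofHom (lmap fun j ↦ (S j).g.hom) = g) :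
    ExtVanish R 1 T (ModuleCat.of R (⨁ j, (S j).X₁)) :=
  extVanish_one_of_exists_lift (S := directSumShortComplex S) (directSum_shortExact hS) hV hl

variable {ι : Type u} [HasColimitsOfShape (Discrete ι) (DerivedCategory (ModuleCat.{u} R))]

lemma exists_comp_lmap {T : ModuleCat.{u} R}
    {V B W : ι → ModuleCat.{u} R} {v : ∀ j, V j ⟶ B j} {u : ∀ j, B j ⟶ W j}
    (hu : ∀ j, Function.Injective (u j))
    (hl : ∀ g : (singleFunctor _ 0).obj T ⟶ ∐ fun j ↦ (singleFunctor _ 0).obj (B j),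
      ∃ h : (singleFunctor _ 0).obj T ⟶ ∐ fun j ↦ (singleFunctor _ 0).obj (V j),
        h ≫ Limits.Sigma.map (fun j ↦ (singleFunctor _ 0).map (v j)) ≫
          Limits.Sigma.map (fun j ↦ (singleFunctor _ 0).map (u j)) =
        g ≫ Limits.Sigma.map (fun j ↦ (singleFunctor _ 0).map (u j)))
    (g : T ⟶ ModuleCat.of R (⨁ j, B j)) :
    ∃ h : T ⟶ ModuleCat.of R (⨁ j, V j), h ≫ ModuleCat.ofHom (lmap fun j ↦ (v j).hom) = g := by
  obtain ⟨e, he⟩ := exists_sigma_single_iso (R := R) (ι := ι)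
  obtain ⟨h, hh⟩ := hl ((singleFunctor (ModuleCat.{u} R) 0).map g ≫ (e _).inv)
  obtain ⟨h', hh'⟩ := (singleFunctor (ModuleCat.{u} R) 0).map_surjective (h ≫ (e _).hom)
  have : Mono (ModuleCat.ofHom (lmap fun j ↦ (u j).hom)) :=
    (ModuleCat.mono_iff_injective _).2 ((lmap_injective _).2 hu)
  refine ⟨h', ?_⟩
  rw [← cancel_mono (ModuleCat.ofHom (lmap fun j ↦ (u j).hom))]
  refine (singleFunctor (ModuleCat.{u} R) 0).map_injective ?_
  rw [Functor.map_comp, Functor.map_comp, Functor.map_comp, hh']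
  have hh := hh =≫ (e W).hom
  simp only [Category.assoc, he] at hh
  rw [reassoc_of% (he V B v)] at hh
  simpa using hh

lemma extVanish_one_directSum {n : ℕ} (hT : IsNTilting R n T)
    (hH : ∀ X : ι → DerivedCategory (ModuleCat.{u} R), (∀ j, InHeart (singleT R T) (X j)) →
      InHeart (singleT R T) (∐ X))
    {N : ι → ModuleCat.{u} R} (hN : ∀ j, ExtVanish R 1 (ModuleCat.of R T) (N j)) :
    ExtVanish R 1 (ModuleCat.of R T) (ModuleCat.of R (⨁ j, (N j : Type u))) := by
  obtain ⟨e, -⟩ := exists_sigma_single_iso (R := R) (ι := ι)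
  choose V B W i v u hiv X₀ X₁ X₂ X₃ I a₀ b₀ δ₀ a₁ b₁ δ₁ a₂ b₂ δ₂ hS hu hV hd₀ hd₁ hd₂ hX₀ hX₃ h₁ h₂
    using fun j ↦ exists_inHeart_coresolution hT (hN j)
  have hV' : ExtVanish R 1 (ModuleCat.of R T) (ModuleCat.of R (⨁ j, V j)) :=
    (inHeart_single_iff (ModuleCat.of R (⨁ j, V j))).1 ((hH _ hV).of_iso (e V)) 1 le_rfl
  refine extVanish_one_directSum_of_exists_lift
    (S := fun j ↦ ShortComplex.mk (i j) (v j) (hiv j)) hS hV' (exists_comp_lmap hu ?_)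
  exact exists_comp_sigma_map hd₀ hd₁ hd₂ (hH _ hX₀ 1 (by lia)) (hH _ hX₃ (-1) (by lia)) h₁ h₂

end InjectiveCoresolution

/-- For an `n`-tilting module `T`, the heart `H` is closed under coproducts in `D(R)` if
and only if the class `T^{⊥₁}` is closed under arbitrary direct sums in `Mod-R`. -/
theorem stmt16 (R : Type u) [Ring R] [HasDerivedCategory.{w} (ModuleCat.{u} R)]
    (n : ℕ) (T : Type u) [AddCommGroup T] [Module R T] (hT : IsNTilting R n T) :
    (∀ (ι : Type u) (X : ι → DerivedCategory (ModuleCat.{u} R)),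
      (∀ i, X i ∈ heartSet R T) →
      ∀ (c : Limits.Cofan X), Limits.IsColimit c → c.pt ∈ heartSet R T) ↔
    (∀ (ι : Type u) (N : ι → ModuleCat.{u} R),
      (∀ i, ExtVanish R 1 (ModuleCat.of R T) (N i)) →
      ExtVanish R 1 (ModuleCat.of R T) (ModuleCat.of R (⨁ i, (N i : Type u)))) := by
  have hsig (ι : Type u) :
      HasColimitsOfShape (Discrete ι) (DerivedCategory (ModuleCat.{u} R)) :=
    DerivedCategory.hasColimitsOfShape_discrete
  refine ⟨fun hH ι N hN ↦ extVanish_one_directSum hT (fun X hX ↦ ?_) hN,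
    fun hN ι X hX c hc ↦ ?_⟩
  · exact (mem_heartSet_iff T _).1
      (hH ι X (fun j ↦ (mem_heartSet_iff T _).2 (hX j)) _ (coproductIsCoproduct X))
  · exact (mem_heartSet_iff T _).2
      ((inHeart_sigma hT (hN ι) fun j ↦ (mem_heartSet_iff T _).1 (hX j)).of_iso
        ((coproductIsCoproduct X).coconePointUniqueUpToIso hc))

end
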